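/- arXiv:1506.02435 — 5 statements merged into one kernel-verified Lean document; each statement's English description precedes it below -/
import Mathlib

section
/- Let Γ be a connected finite simple graph whose adjacency matrix has exactly three distinct eigenvalues θ0 > θ1 > θ2, and suppose 0 < θ1 < 1. Then θ2 > −2. -/
open Polynomial Finset

/-- The multiplicity of a root `α` of `f` depends only on the irreducible factor of `f` that
vanishes at `α`. -/
theorem Polynomial.rootMultiplicity_map_eq_multiplicity {K L : Type*} [Field K] [Field L]
    [Algebra K L] [PerfectField K] {f p : K[X]} (hf : f ≠ 0) (hp : Irreducible p) {α : L}
    (hα : aeval α p = 0) :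
    (f.map (algebraMap K L)).rootMultiplicity α = multiplicity p f := by
  have hfin : FiniteMultiplicity p f := FiniteMultiplicity.of_not_isUnit hp.not_isUnit hf
  obtain ⟨g, hg, hdvd⟩ := hfin.exists_eq_pow_mul_and_not_dvd
  have hfm : f.map (algebraMap K L) ≠ 0 := Polynomial.map_ne_zero hf
  have hpm : p.map (algebraMap K L) ≠ 0 := Polynomial.map_ne_zero hp.ne_zero
  have hgα : (g.map (algebraMap K L)).rootMultiplicity α = 0 := by
    apply rootMultiplicity_eq_zero
    rw [IsRoot.def, eval_map_algebraMap]
    intro h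
    have h2 := minpoly.dvd K α h
    rw [← minpoly.eq_of_irreducible hp hα] at h2
    exact hdvd ((Dvd.intro _ rfl).trans h2)
  have hpα : (p.map (algebraMap K L)).rootMultiplicity α = 1 := by
    apply le_antisymm
    · exact rootMultiplicity_le_one_of_separable (PerfectField.separable_of_irreducible hp).map α
    · rw [Nat.one_le_iff_ne_zero, ← Nat.pos_iff_ne_zero, rootMultiplicity_pos hpm, IsRoot.def,
        eval_map_algebraMap, hα]
  classical
  set k := multiplicity p f
  rw [hg, Polynomial.map_mul, Polynomial.map_pow] at hfm ⊢
  rw [← count_roots, roots_mul hfm, roots_pow, Multiset.count_add, Multiset.count_nsmul,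
    count_roots, count_roots, hpα, hgα, mul_one, add_zero]

namespace Matrix.IsHermitian

variable {n : Type*} [Fintype n] [DecidableEq n] {A : Matrix n n ℝ} (hA : A.IsHermitian)

include hA in
theorem trace_mul_self_eq_sum_sq_eigenvalues :
    (A * A).trace = ∑ i, hA.eigenvalues i ^ 2 := by
  conv_lhs => rw [hA.spectral_theorem, ← map_mul, Unitary.conjStarAlgAut_apply, trace_mul_cycle]
  simp [diagonal_mul_diagonal, trace_diagonal, sq]

theorem rootMultiplicity_charpoly (t : ℝ) :
    A.charpoly.rootMultiplicity t = #{i | hA.eigenvalues i = t} := by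
  rw [← count_roots, hA.roots_charpoly_eq_eigenvalues, Multiset.count_map, Finset.card_def,
    Finset.filter_val]
  simp [eq_comm]

include hA in
theorem posSemidef_smul_one_sub {θ : ℝ} (h : ∀ t ∈ spectrum ℝ A, t ≤ θ) :
    (θ • (1 : Matrix n n ℝ) - A).PosSemidef := by
  rw [posSemidef_iff_isHermitian_and_spectrum_nonneg]
  refine ⟨(isHermitian_one.smul (IsSelfAdjoint.all θ)).sub hA, fun t ht ↦ ?_⟩
  have : θ - t ∈ spectrum ℝ A := by
    rw [← Algebra.algebraMap_eq_smul_one, ← spectrum.singleton_sub_eq] at ht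
    simp at ht
    obtain ⟨s, hs, rfl⟩ := ht
    simpa
  simpa using h _ this

end Matrix.IsHermitian

namespace SimpleGraph

variable {V : Type*} [Fintype V] [DecidableEq V] {G : SimpleGraph V} [DecidableRel G.Adj]

open Matrix

/-- An eigenvector of a connected graph for its largest eigenvalue has no zero entry. -/
theorem Connected.eigenvector_apply_ne_zero (hG : G.Connected) {θ : ℝ}
    (hθ : ∀ t ∈ spectrum ℝ (G.adjMatrix ℝ), t ≤ θ) {x : V → ℝ} (hx : x ≠ 0)
    (hxθ : G.adjMatrix ℝ *ᵥ x = θ • x) (v : V) : x v ≠ 0 := by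
  have hA : (G.adjMatrix ℝ).IsHermitian := by
    simp [Matrix.IsHermitian, conjTranspose_eq_transpose_of_trivial]
  have hP := hA.posSemidef_smul_one_sub hθ
  have habs : G.adjMatrix ℝ *ᵥ |x| = θ • |x| := by
    have h0 : |x| ⬝ᵥ ((θ • (1 : Matrix V V ℝ) - G.adjMatrix ℝ) *ᵥ |x|) = 0 := by
      apply le_antisymm
      · rw [sub_mulVec, smul_mulVec, one_mulVec, dotProduct_sub, sub_nonpos]
        have h1 : |x| ⬝ᵥ (θ • |x|) = x ⬝ᵥ (G.adjMatrix ℝ *ᵥ x) := by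
          rw [hxθ]
          simp [dotProduct, mul_left_comm _ θ]
        rw [h1]
        simp only [dotProduct, mulVec, Finset.mul_sum]
        refine Finset.sum_le_sum fun i _ ↦ Finset.sum_le_sum fun j _ ↦ ?_
        rw [Pi.abs_apply, Pi.abs_apply, adjMatrix_apply]
        split_ifs
        · simpa [abs_mul] using le_abs_self (x i * x j)
        · simp
      · simpa using hP.dotProduct_mulVec_nonneg |x|
    have h1 := (hP.dotProduct_mulVec_zero_iff |x|).1 (by simpa using h0)
    rw [sub_mulVec, smul_mulVec, one_mulVec, sub_eq_zero] at h1
    exact h1.symm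
  intro hv
  apply hx
  have key : ∀ w, G.Reachable v w → x w = 0 := by
    intro w hw
    rw [reachable_iff_reflTransGen] at hw
    induction hw with
    | refl => exact hv
    | @tail b c _ hbc ih =>
      have h2 := congrFun habs b
      rw [adjMatrix_mulVec_apply] at h2
      simp only [Pi.smul_apply, Pi.abs_apply, ih, abs_zero, smul_zero] at h2
      rw [Finset.sum_eq_zero_iff_of_nonneg (fun _ _ ↦ abs_nonneg _)] at h2
      simpa using h2 c (by simpa using hbc)
  ext w
  exact key w (hG.preconnected v w)

/-- The largest eigenvalue of a connected graph is simple. -/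
theorem Connected.card_eigenvalues_eq_le_one (hG : G.Connected)
    (hA : (G.adjMatrix ℝ).IsHermitian) {θ : ℝ}
    (hθ : ∀ t ∈ spectrum ℝ (G.adjMatrix ℝ), t ≤ θ) : #{i | hA.eigenvalues i = θ} ≤ 1 := by
  rw [Finset.card_le_one]
  intro i hi j hj
  simp only [Finset.mem_filter, Finset.mem_univ, true_and] at hi hj
  by_contra hij
  obtain ⟨v⟩ := hG.nonempty
  let b := hA.eigenvectorBasis
  have hb (k : V) (hk : hA.eigenvalues k = θ) :
      G.adjMatrix ℝ *ᵥ (b k : V → ℝ) = θ • (b k : V → ℝ) := by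
    rw [← hk]; exact hA.mulVec_eigenvectorBasis k
  have hlin := b.orthonormal.linearIndependent
  have hbi : (b i : V → ℝ) ≠ 0 := fun h ↦ hlin.ne_zero i (by ext w; exact congrFun h w)
  have hbiv := hG.eigenvector_apply_ne_zero hθ hbi (hb i hi) v
  have hy : (b j v • (b i : V → ℝ) - b i v • (b j : V → ℝ)) = 0 := by
    by_contra hne
    refine hG.eigenvector_apply_ne_zero hθ hne ?_ v (by simp [mul_comm])
    rw [mulVec_sub, mulVec_smul, mulVec_smul, hb i hi, hb j hj, smul_sub, smul_comm θ,
      smul_comm θ]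
  have hy' : b i v • b j = b j v • b i := by
    ext w
    have := congrFun hy w
    simp at this ⊢
    linarith
  have h1 := congrArg (fun z ↦ inner ℝ (b j) z) hy'
  simp [inner_smul_right, orthonormal_iff_ite.1 b.orthonormal, Ne.symm hij] at h1
  exact hbiv h1

omit [DecidableEq V] in
theorem trace_adjMatrix_mul_self_le :
    (G.adjMatrix ℝ * G.adjMatrix ℝ).trace ≤ Fintype.card V * (Fintype.card V - 1 : ℝ) := by
  simp only [trace, diag_apply, adjMatrix_mul_self_apply_self]
  refine (Finset.sum_le_card_nsmul _ _ (Fintype.card V - 1 : ℝ) fun v _ ↦ ?_).trans_eq (by simp)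
  have := G.degree_lt_card_verts v
  have : (G.degree v + 1 : ℝ) ≤ Fintype.card V := by exact_mod_cast this
  linarith

end SimpleGraph

/-- The spectral moment conditions for a simple graph on `1 + m₁ + m₂` vertices force `θ₂ > -2`. -/
theorem neg_two_lt_of_moments {θ0 θ1 θ2 : ℝ} {m₁ m₂ : ℕ} (hm₁ : 1 ≤ m₁) (hm₂ : 1 ≤ m₂)
    (h01 : θ1 < θ0) (hθ1lt : θ1 < 1) (htr : θ0 + m₁ * θ1 + m₂ * θ2 = 0)
    (hsq : θ0 ^ 2 + m₁ * θ1 ^ 2 + m₂ * θ2 ^ 2 ≤ (1 + m₁ + m₂) * (m₁ + m₂))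
    (h : m₁ = 1 ∨ m₁ = m₂ ∧ ∃ s : ℤ, θ1 + θ2 = s) : θ2 > -2 := by
  by_contra! hθ2
  have hsq2 : 4 ≤ θ2 ^ 2 := by nlinarith
  rcases h with rfl | ⟨rfl, s, hs⟩
  · push_cast at htr hsq
    have hm : (1 : ℝ) ≤ m₂ := by exact_mod_cast hm₂
    have h1 : 2 * m₂ - 1 < θ0 := by nlinarith
    have h2 : (m₂ : ℝ) < 2 := by nlinarith [sq_nonneg θ1]
    have h3 : m₂ = 1 := by
      have : m₂ < 2 := by exact_mod_cast h2
      omega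
    subst h3
    push_cast at *
    nlinarith [mul_pos (sub_pos.2 h01) (sub_pos.2 h01)]
  · have hm : (1 : ℝ) ≤ m₁ := by exact_mod_cast hm₁
    have hs1 : (s : ℝ) < -1 := by linarith
    have hs2 : s ≤ -2 := by
      have : s < -1 := by exact_mod_cast hs1
      omega
    have hs3 : (s : ℝ) ≤ -2 := by exact_mod_cast hs2
    have h1 : 2 * m₁ ≤ θ0 := by
      have : θ0 = -(m₁ * s) := by rw [← hs]; linarith
      nlinarith
    nlinarith [mul_nonneg (zero_le_one.trans hm) (sq_nonneg θ1)]

/-- A connected finite simple graph with exactly three distinct adjacency eigenvalues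
θ0 > θ1 > θ2 and 0 < θ1 < 1 has θ2 > −2. -/
theorem second_eigenvalue_strictly_between_zero_one
    {V : Type} [Fintype V] [DecidableEq V] (Γ : SimpleGraph V) [DecidableRel Γ.Adj]
    (θ0 θ1 θ2 : ℝ)
    (hconn : Γ.Connected)
    (h01 : θ0 > θ1) (h12 : θ1 > θ2)
    (hspec : spectrum ℝ (Γ.adjMatrix ℝ) = {θ0, θ1, θ2})
    (hθ1pos : 0 < θ1) (hθ1lt : θ1 < 1) :
    θ2 > -2 := by
  have hA : (Γ.adjMatrix ℝ).IsHermitian := by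
    simp [Matrix.IsHermitian, Matrix.conjTranspose_eq_transpose_of_trivial]
  let m (t : ℝ) : ℕ := #{v | hA.eigenvalues v = t}
  have hrange : Set.range hA.eigenvalues = {θ0, θ1, θ2} := by
    rw [← hspec, hA.spectrum_real_eq_range_eigenvalues]
  have hmpos (t : ℝ) (ht : t ∈ ({θ0, θ1, θ2} : Set ℝ)) : 1 ≤ m t := by
    rw [← hrange] at ht
    obtain ⟨v, hv⟩ := ht
    exact Finset.card_pos.2 ⟨v, by simpa using hv⟩
  have hm0 : m θ0 = 1 := by
    refine le_antisymm (hconn.card_eigenvalues_eq_le_one hA fun t ht ↦ ?_) (hmpos θ0 (by simp))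
    rw [hspec] at ht
    rcases ht with rfl | rfl | rfl <;> linarith
  have hsum (g : ℝ → ℝ) :
      ∑ v, g (hA.eigenvalues v) = g θ0 + m θ1 * g θ1 + m θ2 * g θ2 := by
    have hmaps : ∀ v ∈ (Finset.univ : Finset V),
        hA.eigenvalues v ∈ ({θ0, θ1, θ2} : Finset ℝ) := by
      intro v _
      have : hA.eigenvalues v ∈ ({θ0, θ1, θ2} : Set ℝ) := hrange ▸ Set.mem_range_self v
      simpa using this
    rw [← Finset.sum_fiberwise_of_maps_to' hmaps, Finset.sum_insert, Finset.sum_insert,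
      Finset.sum_singleton]
    · simp only [Finset.sum_const, nsmul_eq_mul]
      change (m θ0 : ℝ) * _ + (m θ1 * _ + m θ2 * _) = _
      rw [hm0]
      ring
    · simpa using h12.ne'
    · simpa using ⟨h01.ne', (h12.trans h01).ne'⟩
  have hcard : (Fintype.card V : ℝ) = 1 + m θ1 + m θ2 := by
    simpa using hsum fun _ ↦ 1
  have htr : θ0 + m θ1 * θ1 + m θ2 * θ2 = 0 := by
    simpa using (hsum id).symm.trans hA.trace_eq_sum_eigenvalues.symm
  have hsq : θ0 ^ 2 + m θ1 * θ1 ^ 2 + m θ2 * θ2 ^ 2 ≤ (1 + m θ1 + m θ2) * (m θ1 + m θ2) := by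
    rw [← hsum (· ^ 2), ← hA.trace_mul_self_eq_sum_sq_eigenvalues]
    refine SimpleGraph.trace_adjMatrix_mul_self_le.trans_eq ?_
    rw [hcard]
    ring
  refine neg_two_lt_of_moments (hmpos θ1 (by simp)) (hmpos θ2 (by simp)) h01 hθ1lt htr hsq ?_
  have hchar (R : Type) [CommRing R] (φ : R →+* ℝ) :
      (Γ.adjMatrix R).charpoly.map φ = (Γ.adjMatrix ℝ).charpoly := by
    rw [← Matrix.charpoly_map]
    congr 1
    ext i j
    simp [SimpleGraph.adjMatrix_apply, apply_ite φ]
  have hroot : (Γ.adjMatrix ℝ).charpoly.IsRoot θ1 := by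
    rw [← Matrix.mem_spectrum_iff_isRoot_charpoly, hspec]
    simp
  have hint : IsIntegral ℤ θ1 :=
    ⟨_, (Γ.adjMatrix ℤ).charpoly_monic, by
      rw [← eval_map, hchar]; exact hroot⟩
  set p := minpoly ℚ θ1
  have hpirr : Irreducible p := minpoly.irreducible hint.tower_top
  have hpq : p = (minpoly ℤ θ1).map (algebraMap ℤ ℚ) :=
    minpoly.isIntegrallyClosed_eq_field_fractions' ℚ hint
  have hmult (t : ℝ) (ht : aeval t p = 0) : m t = multiplicity p (Γ.adjMatrix ℚ).charpoly := by
    rw [← Polynomial.rootMultiplicity_map_eq_multiplicity (Matrix.charpoly_monic _).ne_zero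
      hpirr ht, hchar, hA.rootMultiplicity_charpoly]
  have hmult1 := hmult θ1 (minpoly.aeval ℚ θ1)
  set P := p.map (algebraMap ℚ ℝ) with hP
  have hPmonic : P.Monic := (minpoly.monic hint.tower_top).map _
  have hPdvd : P ∣ (Γ.adjMatrix ℝ).charpoly := by
    rw [← hchar ℚ (algebraMap ℚ ℝ)]
    refine Polynomial.map_dvd _ (minpoly.dvd ℚ θ1 ?_)
    rw [← eval_map_algebraMap, hchar]
    exact hroot
  have hPsplits : P.Splits := hA.splits_charpoly.of_dvd (Matrix.charpoly_monic _).ne_zero hPdvd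
  have hPnodup : P.roots.Nodup :=
    nodup_roots (PerfectField.separable_of_irreducible hpirr).map
  have hProot (t : ℝ) : t ∈ P.roots ↔ aeval t p = 0 := by
    rw [mem_roots hPmonic.ne_zero, IsRoot.def, hP, eval_map_algebraMap]
  have hPspec (t : ℝ) (ht : t ∈ P.roots) : t = θ0 ∨ t = θ1 ∨ t = θ2 := by
    have : t ∈ spectrum ℝ (Γ.adjMatrix ℝ) := by
      rw [Matrix.mem_spectrum_iff_isRoot_charpoly]
      exact (isRoot_of_mem_roots ht).dvd hPdvd
    rw [hspec] at this
    simpa using this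
  have hPsum : ∃ s : ℤ, P.roots.toFinset.sum id = s := by
    refine ⟨-(minpoly ℤ θ1).nextCoeff, ?_⟩
    have h1 := hPsplits.nextCoeff_eq_neg_sum_roots_of_monic hPmonic
    have h2 : P.roots.toFinset.sum id = P.roots.sum := by
      simp [Finset.sum, hPnodup.dedup]
    have h3 : P = (minpoly ℤ θ1).map (Int.castRingHom ℝ) := by
      rw [hP, hpq, Polynomial.map_map]
      congr 1
    rw [h3, nextCoeff_map (RingHom.injective_int _)] at h1
    rw [h2, h3]
    simp at h1 ⊢
    linarith
  have h1root : θ1 ∈ P.roots := (hProot θ1).2 (minpoly.aeval ℚ θ1)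
  by_cases h0 : θ0 ∈ P.roots
  · left
    rw [← hm0, hmult1, hmult θ0 ((hProot _).1 h0)]
  right
  by_cases h2 : θ2 ∈ P.roots
  · refine ⟨by rw [hmult1, hmult θ2 ((hProot _).1 h2)], ?_⟩
    have : P.roots.toFinset = {θ1, θ2} := by
      ext t
      rw [Multiset.mem_toFinset, Finset.mem_insert, Finset.mem_singleton]
      constructor
      · intro ht
        rcases hPspec t ht with rfl | h
        · exact absurd ht h0
        · exact h
      · rintro (rfl | rfl) <;> assumption
    simpa [this, Finset.sum_pair h12.ne'] using hPsum
  · exfalso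
    have : P.roots.toFinset = {θ1} := by
      ext t
      rw [Multiset.mem_toFinset, Finset.mem_singleton]
      constructor
      · intro ht
        rcases hPspec t ht with rfl | h | rfl
        · exact absurd ht h0
        · exact h
        · exact absurd ht h2
      · rintro rfl
        assumption
    obtain ⟨s, hs⟩ := hPsum
    rw [this, Finset.sum_singleton, id] at hs
    rw [hs] at hθ1pos hθ1lt
    norm_cast at hθ1pos hθ1lt
    omega
end

section
/- Let Γ be a connected finite simple graph that is nonbipartite and nonregular, whose adjacency matrix has exactly three distinct eigenvalues θ0 > θ1 > θ2, and suppose θ1 ≤ 1. Then θ1 = 1 and both θ0 and θ2 are integers. -/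
section
open Polynomial

lemma rootMultiplicity_eq_of_minpoly_eq (χ : ℤ[X]) {a b : ℝ} (ha : IsIntegral ℤ a)
    (h : minpoly ℚ a = minpoly ℚ b) :
    (χ.map (Int.castRingHom ℝ)).rootMultiplicity a =
      (χ.map (Int.castRingHom ℝ)).rootMultiplicity b := by
  have ha' : IsIntegral ℚ a := ha.tower_top
  have : Fact (Irreducible (minpoly ℚ a)) := ⟨minpoly.irreducible ha'⟩
  have key : ∀ c : ℝ, aeval c (minpoly ℚ a) = 0 →
      (χ.map (Int.castRingHom ℝ)).rootMultiplicity c =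
        (χ.map (Int.castRingHom (AdjoinRoot (minpoly ℚ a)))).rootMultiplicity
          (AdjoinRoot.root (minpoly ℚ a)) := by
    intro c hc
    have hc2 : eval₂ (algebraMap ℚ ℝ) c (minpoly ℚ a) = 0 := by rwa [← aeval_def]
    have := eq_rootMultiplicity_map
      (p := χ.map (Int.castRingHom (AdjoinRoot (minpoly ℚ a))))
      (RingHom.injective (AdjoinRoot.lift (algebraMap ℚ ℝ) c hc2)) (AdjoinRoot.root (minpoly ℚ a))
    rw [this, AdjoinRoot.lift_root, Polynomial.map_map]
    congr 2
    exact (RingHom.eq_intCast' _).symm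
  rw [key a (minpoly.aeval ℚ a), key b (h ▸ minpoly.aeval ℚ b)]

lemma exists_int_prod_conjugates (χ : ℤ[X]) (hχ : χ.Monic) (S : Finset ℝ)
    (hS : ∀ t, t ∈ S ↔ aeval t χ = 0) (hsplit : (χ.map (Int.castRingHom ℝ)).Splits)
    {a : ℝ} (ha : a ∈ S) (z : ℤ) :
    ∃ w : ℤ, ∏ t ∈ S with minpoly ℚ t = minpoly ℚ a, ((z : ℝ) - t) = w := by
  have hint : IsIntegral ℤ a := ⟨χ, hχ, (hS a).1 ha⟩
  have hdvd : minpoly ℤ a ∣ χ := minpoly.isIntegrallyClosed_dvd hint ((hS a).1 ha)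
  have hQ : minpoly ℚ a = (minpoly ℤ a).map (algebraMap ℤ ℚ) :=
    minpoly.isIntegrallyClosed_eq_field_fractions' ℚ hint
  have hmap : (minpoly ℤ a).map (Int.castRingHom ℝ) = (minpoly ℚ a).map (algebraMap ℚ ℝ) := by
    rw [hQ, Polynomial.map_map]; rfl
  set q := (minpoly ℤ a).map (Int.castRingHom ℝ) with hq
  have hmon : q.Monic := (minpoly.monic hint).map _
  have hqs : q.Splits := hsplit.of_dvd (hχ.map _).ne_zero (Polynomial.map_dvd _ hdvd)
  have hnd : q.roots.Nodup := by
    apply nodup_roots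
    rw [hmap]
    exact (minpoly.irreducible hint.tower_top).separable.map
  have hset : q.roots.toFinset = S.filter (fun t => minpoly ℚ t = minpoly ℚ a) := by
    ext t
    rw [Multiset.mem_toFinset, mem_roots hmon.ne_zero, Finset.mem_filter, hS, hmap, IsRoot.def,
      eval_map_algebraMap]
    constructor
    · intro ht
      refine ⟨?_, (minpoly.eq_of_irreducible_of_monic (minpoly.irreducible hint.tower_top) ht
        (minpoly.monic hint.tower_top)).symm⟩
      obtain ⟨r, hr⟩ := hdvd
      have : aeval t (minpoly ℤ a) = 0 := by
        rwa [hQ, aeval_map_algebraMap] at ht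
      rw [hr, map_mul, this, zero_mul]
    · rintro ⟨-, ht⟩
      rw [← ht]
      exact minpoly.aeval ℚ t
  refine ⟨(minpoly ℤ a).eval z, ?_⟩
  have h1 : ((((minpoly ℤ a).eval z : ℤ)) : ℝ) = q.eval (z : ℝ) := by
    rw [hq, eval_intCast_map]; simp
  rw [h1, ← hset, hqs.eval_eq_prod_roots, hmon.leadingCoeff, one_mul, Finset.prod,
    Multiset.toFinset_val, hnd.dedup]

end

section
open Matrix

lemma eq_of_connected {V : Type*} {G : SimpleGraph V} {β : Type*} (hG : G.Connected) (f : V → β)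
    (h : ∀ x y, G.Adj x y → f x = f y) (x y : V) : f x = f y := by
  obtain ⟨w⟩ := hG.preconnected x y
  induction w with
  | nil => rfl
  | cons hadj _ ih => exact (h _ _ hadj).trans ih

lemma sub_smul_one_mulVec {V : Type*} [Fintype V] [DecidableEq V]
    {A : Matrix V V ℝ} {s t : ℝ} {v : V → ℝ} (h : A *ᵥ v = s • v) :
    (A - t • (1 : Matrix V V ℝ)) *ᵥ v = (s - t) • v := by
  rw [sub_mulVec, h, smul_mulVec, one_mulVec, sub_smul]

section
variable {V : Type*} [Fintype V] [DecidableEq V] {G : SimpleGraph V} [DecidableRel G.Adj]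

lemma adjMatrix_mulVec_abs {θ : ℝ} (hP : (θ • (1 : Matrix V V ℝ) - G.adjMatrix ℝ).PosSemidef)
    {β : V → ℝ} (hβ : G.adjMatrix ℝ *ᵥ β = θ • β) :
    G.adjMatrix ℝ *ᵥ |β| = θ • |β| := by
  have hnn := hP.dotProduct_mulVec_nonneg |β|
  have hle : star |β| ⬝ᵥ ((θ • (1 : Matrix V V ℝ) - G.adjMatrix ℝ) *ᵥ |β|) ≤ 0 := by
    have h0 : β ⬝ᵥ ((θ • (1 : Matrix V V ℝ) - G.adjMatrix ℝ) *ᵥ β) = 0 := by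
      rw [sub_mulVec, smul_mulVec, one_mulVec, hβ, sub_self, dotProduct_zero]
    rw [← h0]
    simp only [sub_mulVec, smul_mulVec, one_mulVec, dotProduct, star_trivial, Pi.sub_apply,
      Pi.smul_apply, smul_eq_mul, SimpleGraph.adjMatrix_mulVec_apply, Pi.abs_apply]
    refine Finset.sum_le_sum fun x _ => ?_
    have : β x * ∑ u ∈ G.neighborFinset x, β u ≤ |β x| * ∑ u ∈ G.neighborFinset x, |β u| := by
      refine (le_abs_self _).trans ?_
      rw [abs_mul]
      exact mul_le_mul_of_nonneg_left (Finset.abs_sum_le_sum_abs _ _) (abs_nonneg _)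
    rw [mul_sub, mul_sub, mul_left_comm, mul_left_comm (β x), abs_mul_abs_self]
    linarith
  have := (hP.dotProduct_mulVec_zero_iff |β|).1 (le_antisymm hle hnn)
  rw [sub_mulVec, smul_mulVec, one_mulVec, sub_eq_zero] at this
  exact this.symm

lemma eq_zero_of_apply_eq_zero (hG : G.Connected) {θ : ℝ}
    (hP : (θ • (1 : Matrix V V ℝ) - G.adjMatrix ℝ).PosSemidef)
    {β : V → ℝ} (hβ : G.adjMatrix ℝ *ᵥ β = θ • β) {x : V} (hx : β x = 0) : β = 0 := by
  have habs := adjMatrix_mulVec_abs hP hβ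
  have hstep : ∀ u v, G.Adj u v → β u = 0 → β v = 0 := by
    intro u v huv hu
    have h := congrFun habs u
    simp only [SimpleGraph.adjMatrix_mulVec_apply, Pi.smul_apply, Pi.abs_apply, hu, abs_zero,
      smul_zero] at h
    rw [Finset.sum_eq_zero_iff_of_nonneg fun _ _ => abs_nonneg _] at h
    exact abs_eq_zero.1 (h v (by simpa using huv))
  funext y
  have := eq_of_connected hG (fun v => β v = 0)
    (fun u v h => propext ⟨hstep u v h, hstep v u h.symm⟩) x y
  exact this.mp hx

lemma exists_pos_eigenvector (hG : G.Connected) {θ : ℝ}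
    (hP : (θ • (1 : Matrix V V ℝ) - G.adjMatrix ℝ).PosSemidef)
    {β : V → ℝ} (hβ : G.adjMatrix ℝ *ᵥ β = θ • β) (hβ0 : β ≠ 0) :
    ∃ α : V → ℝ, (∀ x, 0 < α x) ∧ G.adjMatrix ℝ *ᵥ α = θ • α ∧
      ∀ γ : V → ℝ, G.adjMatrix ℝ *ᵥ γ = θ • γ → ∃ k : ℝ, γ = k • α := by
  have habs := adjMatrix_mulVec_abs hP hβ
  have hpos : ∀ x, 0 < |β| x := fun x =>
    abs_pos.2 fun h => hβ0 (eq_zero_of_apply_eq_zero hG hP hβ h)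
  refine ⟨|β|, hpos, habs, fun γ hγ => ?_⟩
  obtain ⟨x⟩ := hG.nonempty
  refine ⟨γ x / |β| x, sub_eq_zero.1 (eq_zero_of_apply_eq_zero hG hP (x := x) ?_ ?_)⟩
  · rw [mulVec_sub, mulVec_smul, hγ, habs, smul_sub, smul_comm]
  · rw [Pi.sub_apply, Pi.smul_apply, smul_eq_mul, div_mul_cancel₀ _ (hpos x).ne', sub_self]

lemma exists_rank_one_decomposition (hG : G.Connected) {θ0 θ1 θ2 : ℝ}
    (h01 : θ0 > θ1) (h12 : θ1 > θ2)
    (hspec : spectrum ℝ (G.adjMatrix ℝ) = {θ0, θ1, θ2}) :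
    ∃ α : V → ℝ, (∀ x, 0 < α x) ∧ G.adjMatrix ℝ *ᵥ α = θ0 • α ∧
      (∀ γ : V → ℝ, G.adjMatrix ℝ *ᵥ γ = θ0 • γ → ∃ k : ℝ, γ = k • α) ∧
      (G.adjMatrix ℝ - θ1 • 1) * (G.adjMatrix ℝ - θ2 • 1) = vecMulVec α α ∧
      α ⬝ᵥ α = (θ0 - θ1) * (θ0 - θ2) := by
  have hA := SimpleGraph.isHermitian_adjMatrix ℝ G
  set A := G.adjMatrix ℝ with hAdef
  have hrange := hA.spectrum_real_eq_range_eigenvalues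
  rw [hspec] at hrange
  have hP : (θ0 • (1 : Matrix V V ℝ) - A).PosSemidef := by
    rw [posSemidef_iff_isHermitian_and_spectrum_nonneg]
    refine ⟨?_, ?_⟩
    · refine IsHermitian.sub ?_ hA
      simp [IsHermitian]
    · rw [← Algebra.algebraMap_eq_smul_one, ← spectrum.singleton_sub_eq, hspec]
      rintro _ ⟨a, rfl, b, hb, rfl⟩
      simp only [Set.mem_insert_iff, Set.mem_singleton_iff, Set.mem_ofPred_eq] at *
      rcases hb with rfl | rfl | rfl <;> linarith
  obtain ⟨i, hi⟩ : ∃ i, hA.eigenvalues i = θ0 := by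
    have : θ0 ∈ Set.range hA.eigenvalues := hrange ▸ by simp
    exact this
  have hv := hA.mulVec_eigenvectorBasis i
  rw [hi] at hv
  obtain ⟨α, hpos, hα, huniq⟩ := exists_pos_eigenvector hG hP hv (by
    intro h
    exact hA.eigenvectorBasis.orthonormal.ne_zero i (by ext x; exact congrFun h x))
  have hcomm : Commute (A - θ1 • (1 : Matrix V V ℝ)) (A - θ2 • 1) := by
    have h1 (t : ℝ) : Commute A (A - t • (1 : Matrix V V ℝ)) :=
      (Commute.refl A).sub_right ((Commute.one_right A).smul_right t)
    exact (h1 θ2).sub_left ((Commute.one_left _).smul_left θ1)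
  set M := (A - θ1 • (1 : Matrix V V ℝ)) * (A - θ2 • 1) with hM
  have hcube : (A - θ0 • (1 : Matrix V V ℝ)) * M = 0 := by
    have hkill : ∀ j, ((A - θ0 • (1 : Matrix V V ℝ)) * M) *ᵥ (hA.eigenvectorBasis j).ofLp = 0 := by
      intro j
      have hj := hA.mulVec_eigenvectorBasis j
      have hmem : hA.eigenvalues j ∈ ({θ0, θ1, θ2} : Set ℝ) := hrange ▸ Set.mem_range_self j
      rw [hM, ← mulVec_mulVec, ← mulVec_mulVec, sub_smul_one_mulVec hj, mulVec_smul,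
        sub_smul_one_mulVec hj, smul_smul, mulVec_smul, sub_smul_one_mulVec hj, smul_smul]
      rcases hmem with h | h | h <;> rw [h] <;> simp
    apply (toEuclideanLin (𝕜 := ℝ)).injective
    rw [map_zero]
    refine hA.eigenvectorBasis.toBasis.ext fun j => ?_
    rw [OrthonormalBasis.coe_toBasis, toLpLin_apply, hkill j]
    rfl
  have hMα : M *ᵥ α = ((θ0 - θ1) * (θ0 - θ2)) • α := by
    rw [hM, ← mulVec_mulVec, sub_smul_one_mulVec hα, mulVec_smul, sub_smul_one_mulVec hα,
      smul_smul, mul_comm]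
  have hMsymm : Mᵀ = M := by
    rw [hM, transpose_mul, transpose_sub, transpose_sub, hAdef, SimpleGraph.transpose_adjMatrix,
      transpose_smul, transpose_smul, transpose_one]
    exact hcomm.symm.eq
  have hcol : ∀ y, ∃ k : ℝ, M.col y = k • α := fun y => by
    apply huniq
    have h := congrArg (fun N => N *ᵥ Pi.single y 1) hcube
    beta_reduce at h
    rw [← mulVec_mulVec, mulVec_single_one, zero_mulVec, sub_mulVec, smul_mulVec,
      one_mulVec, sub_eq_zero] at h
    exact h
  choose k hk using hcol
  have hMxy : ∀ x y, M x y = k y * α x := fun x y => congrFun (hk y) x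
  obtain ⟨x0⟩ := hG.nonempty
  have hkα : ∀ y, k y = k x0 / α x0 * α y := fun y => by
    have h1 : M x0 y = M y x0 := congrFun (congrFun hMsymm y) x0
    rw [hMxy, hMxy] at h1
    field_simp [(hpos x0).ne']
    linarith
  set κ := k x0 / α x0 with hκ
  have hMκ : M = κ • vecMulVec α α := by
    ext x y
    rw [hMxy, hkα]
    simp [vecMulVec_apply]
    ring
  have hsq : κ * (α ⬝ᵥ α) = (θ0 - θ1) * (θ0 - θ2) := by
    have := congrFun hMα x0
    rw [hMκ, smul_mulVec, vecMulVec_mulVec] at this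
    simp only [Pi.smul_apply, smul_eq_mul, MulOpposite.smul_eq_mul_unop, MulOpposite.unop_op] at this
    have h0 := (hpos x0).ne'
    apply mul_right_cancel₀ h0
    linarith
  have hκpos : 0 < κ := by
    have h1 : 0 < (θ0 - θ1) * (θ0 - θ2) := mul_pos (by linarith) (by linarith)
    have h2 : 0 ≤ α ⬝ᵥ α := Finset.sum_nonneg fun _ _ => mul_self_nonneg _
    by_contra! h
    nlinarith
  have hs : 0 < √κ := Real.sqrt_pos.2 hκpos
  have hss : √κ * √κ = κ := Real.mul_self_sqrt hκpos.le
  refine ⟨√κ • α, fun x => mul_pos hs (hpos x), ?_, ?_, ?_, ?_⟩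
  · rw [mulVec_smul, hα, smul_comm]
  · intro γ hγ
    obtain ⟨c, hc⟩ := huniq γ hγ
    exact ⟨c / √κ, by rw [smul_smul, div_mul_cancel₀ _ hs.ne', hc]⟩
  · rw [hMκ, ← hss]
    ext x y
    simp [vecMulVec_apply]
    ring
  · rw [smul_dotProduct, dotProduct_smul, smul_smul, hss, smul_eq_mul, hsq]

lemma charpoly_adjMatrix_map :
    (G.adjMatrix ℤ).charpoly.map (Int.castRingHom ℝ) = (G.adjMatrix ℝ).charpoly := by
  rw [← charpoly_map]
  congr 1
  ext x y
  simp [SimpleGraph.adjMatrix_apply, apply_ite]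

lemma rootMultiplicity_charpoly_eq_card {A : Matrix V V ℝ} (hA : A.IsHermitian) (t : ℝ) :
    A.charpoly.rootMultiplicity t = Finset.card {i | hA.eigenvalues i = t} := by
  rw [← Polynomial.count_roots, hA.roots_charpoly_eq_eigenvalues, Multiset.count_map, Finset.card,
    Finset.filter_val]
  congr 2
  funext i
  simp [eq_comm]

lemma sum_rootMultiplicity_charpoly {A : Matrix V V ℝ} (hA : A.IsHermitian) {θ0 θ1 θ2 : ℝ}
    (h01 : θ0 > θ1) (h12 : θ1 > θ2) (hspec : spectrum ℝ A = {θ0, θ1, θ2}) :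
    A.charpoly.rootMultiplicity θ0 + A.charpoly.rootMultiplicity θ1 +
      A.charpoly.rootMultiplicity θ2 = Fintype.card V ∧
    A.charpoly.rootMultiplicity θ0 * θ0 + A.charpoly.rootMultiplicity θ1 * θ1 +
      A.charpoly.rootMultiplicity θ2 * θ2 = A.trace := by
  have hmem : ∀ i ∈ (Finset.univ : Finset V), hA.eigenvalues i ∈ ({θ0, θ1, θ2} : Finset ℝ) := by
    intro i _
    have : hA.eigenvalues i ∈ ({θ0, θ1, θ2} : Set ℝ) :=
      hspec ▸ hA.eigenvalues_mem_spectrum_real i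
    simpa using this
  have hn0 : θ0 ∉ ({θ1, θ2} : Finset ℝ) := by
    simp [h01.ne', (h12.trans h01).ne']
  have hn1 : θ1 ∉ ({θ2} : Finset ℝ) := by simp [h12.ne']
  constructor
  · rw [← Finset.card_univ, Finset.card_eq_sum_card_fiberwise hmem, Finset.sum_insert hn0,
      Finset.sum_insert hn1, Finset.sum_singleton]
    simp only [rootMultiplicity_charpoly_eq_card hA, add_assoc]
  · rw [hA.trace_eq_sum_eigenvalues, ← Finset.sum_fiberwise_of_maps_to hmem,
      Finset.sum_insert hn0, Finset.sum_insert hn1, Finset.sum_singleton]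
    have hf : ∀ t, ∑ i with hA.eigenvalues i = t, (RCLike.ofReal (hA.eigenvalues i) : ℝ) =
        A.charpoly.rootMultiplicity t * t := by
      intro t
      rw [rootMultiplicity_charpoly_eq_card hA, ← nsmul_eq_mul, ← Finset.sum_const]
      refine Finset.sum_congr rfl fun i hi => ?_
      simpa using hi
    rw [hf, hf, hf, add_assoc]

lemma rootMultiplicity_charpoly_eq_one {A : Matrix V V ℝ} (hA : A.IsHermitian) {θ : ℝ}
    (hθ : θ ∈ spectrum ℝ A) {α : V → ℝ}
    (h : ∀ γ : V → ℝ, A *ᵥ γ = θ • γ → ∃ k : ℝ, γ = k • α) :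
    A.charpoly.rootMultiplicity θ = 1 := by
  rw [rootMultiplicity_charpoly_eq_card hA, Finset.card_eq_one]
  rw [hA.spectrum_real_eq_range_eigenvalues] at hθ
  obtain ⟨i, hi⟩ := hθ
  refine ⟨i, Finset.ext fun j => ?_⟩
  simp only [Finset.mem_filter, Finset.mem_univ, true_and, Finset.mem_singleton]
  refine ⟨fun hj => ?_, fun hj => hj ▸ hi⟩
  by_contra hij
  obtain ⟨k, hk⟩ := h _ (hi ▸ hA.mulVec_eigenvectorBasis i)
  obtain ⟨l, hl⟩ := h _ (hj ▸ hA.mulVec_eigenvectorBasis j)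
  have hne (a : V) : (hA.eigenvectorBasis a).ofLp ≠ 0 := fun h0 =>
    hA.eigenvectorBasis.orthonormal.ne_zero a (by ext x; exact congrFun h0 x)
  have horth := hA.eigenvectorBasis.orthonormal.2 hij
  beta_reduce at horth
  rw [EuclideanSpace.inner_eq_star_dotProduct, star_trivial, hk, hl, smul_dotProduct,
    dotProduct_smul, smul_eq_mul, smul_eq_mul, mul_eq_zero, mul_eq_zero] at horth
  rcases horth with h0 | h0 | h0
  · exact hne i (by rw [hk, h0, zero_smul])
  · exact hne j (by rw [hl, h0, zero_smul])
  · exact hne i (by rw [hk, dotProduct_self_eq_zero.1 h0, smul_zero])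

end

lemma exists_degree_ne_of_not_regular {V : Type*} [Fintype V] {G : SimpleGraph V} [DecidableRel G.Adj]
    [Nonempty V] (hnonreg : ¬ ∃ k, G.IsRegularOfDegree k) :
    ∃ x y, G.degree x ≠ G.degree y := by
  by_contra! h
  exact hnonreg ⟨G.degree (Classical.arbitrary V), fun x => h _ _⟩

lemma four_le_card {V : Type*} [Fintype V] [DecidableEq V] {G : SimpleGraph V}
    (hnonbip : ¬ G.Colorable 2) {x y : V} (hxy : x ≠ y) (hadj : ¬ G.Adj x y) :
    4 ≤ Fintype.card V := by
  by_contra! hlt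
  apply hnonbip
  have hcard : (({x, y} : Finset V)ᶜ).card ≤ 1 := by
    rw [Finset.card_compl, Finset.card_pair hxy]
    omega
  have hadj' : ¬ G.Adj y x := fun h => hadj h.symm
  refine ⟨SimpleGraph.Coloring.mk (fun v => if v ∈ ({x, y} : Finset V) then 0 else 1) ?_⟩
  intro u v huv
  split_ifs with hu hv hv
  · simp only [Finset.mem_insert, Finset.mem_singleton] at hu hv
    rcases hu with rfl | rfl <;> rcases hv with rfl | rfl <;> simp_all
  · simp
  · simp
  · exact absurd (Finset.card_le_one.1 hcard u (by simpa using hu) v (by simpa using hv)) huv.ne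

lemma degree_eq_of_sq {V : Type*} [Fintype V] {G : SimpleGraph V} [DecidableRel G.Adj]
    {α : V → ℝ} {θ1 θ2 : ℝ}
    (hdiag : ∀ x, (G.degree x : ℝ) + θ1 * θ2 = α x ^ 2) {x y : V}
    (h : α x = α y) : G.degree x = G.degree y := by
  have h1 := hdiag x
  rw [h, ← hdiag y] at h1
  exact_mod_cast add_right_cancel h1

lemma perron_add_mul_pos {V : Type*} [Fintype V] {G : SimpleGraph V} [DecidableRel G.Adj]
    {α : V → ℝ} {θ0 θ1 θ2 : ℝ} [Nonempty V]
    (hpos : ∀ x, 0 < α x) (hdiag : ∀ x, (G.degree x : ℝ) + θ1 * θ2 = α x ^ 2)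
    (hα : ∀ x, ∑ u ∈ G.neighborFinset x, α u = θ0 * α x) :
    0 < θ0 + θ1 * θ2 := by
  obtain ⟨x, hx⟩ := Finite.exists_min α
  have h1 : (G.degree x : ℝ) * α x ≤ θ0 * α x := by
    rw [← hα, ← nsmul_eq_mul, ← SimpleGraph.card_neighborFinset_eq_degree]
    exact Finset.card_nsmul_le_sum _ _ _ fun u _ => hx u
  have h2 := le_of_mul_le_mul_right h1 (hpos x)
  have := hdiag x
  have := pow_pos (hpos x) 2
  linarith

section
variable {V : Type*} [Fintype V] [DecidableEq V] {G : SimpleGraph V} [DecidableRel G.Adj]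

lemma adjMatrix_mul_self_apply (x y : V) :
    (G.adjMatrix ℝ * G.adjMatrix ℝ) x y =
      ((G.neighborFinset x ∩ G.neighborFinset y).card : ℝ) := by
  rw [SimpleGraph.adjMatrix_mul_apply]
  simp only [SimpleGraph.adjMatrix_apply, Finset.sum_boole]
  congr 2
  ext u
  simp [G.adj_comm u y]

lemma rank_one_apply {θ1 θ2 : ℝ} {α : V → ℝ}
    (h : (G.adjMatrix ℝ - θ1 • 1) * (G.adjMatrix ℝ - θ2 • 1) = vecMulVec α α) (x y : V) :
    ((G.neighborFinset x ∩ G.neighborFinset y).card : ℝ) - (θ1 + θ2) * G.adjMatrix ℝ x y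
      + θ1 * θ2 * (1 : Matrix V V ℝ) x y = α x * α y := by
  have h1 := congrFun (congrFun h x) y
  rw [vecMulVec_apply] at h1
  rw [← h1, ← adjMatrix_mul_self_apply]
  simp only [sub_mul, mul_sub, smul_mul_assoc, mul_smul_comm, mul_one, one_mul, Matrix.sub_apply,
    Matrix.smul_apply, smul_eq_mul]
  ring

variable {α : V → ℝ} {θ0 θ1 θ2 : ℝ}

lemma exists_not_adj_of_not_regular (hnonreg : ¬ ∃ k, G.IsRegularOfDegree k) :
    ∃ x y, x ≠ y ∧ ¬ G.Adj x y := by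
  by_contra! h
  refine hnonreg ⟨Fintype.card V - 1, fun x => ?_⟩
  have : G.neighborFinset x = Finset.univ.erase x := by
    ext y
    simp only [SimpleGraph.mem_neighborFinset, Finset.mem_erase, Finset.mem_univ, and_true]
    exact ⟨fun hxy => hxy.ne', fun hxy => h x y hxy.symm⟩
  rw [← SimpleGraph.card_neighborFinset_eq_degree, this, Finset.card_erase_of_mem (by simp),
    Finset.card_univ]

lemma card_common_le_degree (x y : V) :
    (G.neighborFinset x ∩ G.neighborFinset y).card ≤ G.degree y := by
  rw [← SimpleGraph.card_neighborFinset_eq_degree]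
  exact Finset.card_le_card Finset.inter_subset_right

lemma card_common_add_one_le_degree {x y : V} (h : G.Adj x y) :
    (G.neighborFinset x ∩ G.neighborFinset y).card + 1 ≤ G.degree y := by
  rw [← SimpleGraph.card_neighborFinset_eq_degree]
  refine Finset.card_lt_card ⟨Finset.inter_subset_right, fun hs => ?_⟩
  have := hs ((SimpleGraph.mem_neighborFinset _ _ _).2 h.symm)
  simp at this

lemma regular_of_eq_neg_one (hG : G.Connected)
    (hpos : ∀ x, 0 < α x) (hdiag : ∀ x, (G.degree x : ℝ) + θ1 * (-1) = α x ^ 2)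
    (hadj : ∀ x y, G.Adj x y → ((G.neighborFinset x ∩ G.neighborFinset y).card : ℝ) =
      θ1 + -1 + α x * α y) : ∃ k, G.IsRegularOfDegree k := by
  have hle : ∀ x y, G.Adj x y → α x ≤ α y := fun x y h => by
    have h1 : ((G.neighborFinset x ∩ G.neighborFinset y).card : ℝ) + 1 ≤ G.degree y := by
      exact_mod_cast card_common_add_one_le_degree h
    rw [hadj x y h] at h1
    have := hdiag y
    refine le_of_mul_le_mul_right (a := α y) ?_ (hpos y)
    nlinarith
  obtain ⟨x⟩ := hG.nonempty
  refine ⟨G.degree x, fun y => degree_eq_of_sq hdiag ?_⟩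
  exact eq_of_connected hG α (fun u v h => le_antisymm (hle u v h) (hle v u h.symm)) y x

lemma lt_card_sub_one (hG : G.Connected) (hnonreg : ¬ ∃ k, G.IsRegularOfDegree k)
    (hpos : ∀ x, 0 < α x) (hdiag : ∀ x, (G.degree x : ℝ) + θ1 * θ2 = α x ^ 2)
    (hα : ∀ x, ∑ u ∈ G.neighborFinset x, α u = θ0 * α x) :
    θ0 < Fintype.card V - 1 := by
  have := hG.nonempty
  by_contra! hge
  obtain ⟨x, hx⟩ := Finite.exists_max α
  have hsub : G.neighborFinset x ⊆ Finset.univ.erase x := fun y hy => by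
    simpa using (G.ne_of_adj ((SimpleGraph.mem_neighborFinset _ _ _).1 hy)).symm
  have h1 : θ0 * α x ≤ ∑ u ∈ Finset.univ.erase x, α u := by
    rw [← hα]
    exact Finset.sum_le_sum_of_subset_of_nonneg hsub fun u _ _ => (hpos u).le
  have h2 : ∑ u ∈ Finset.univ.erase x, (α x - α u) ≤ 0 := by
    rw [Finset.sum_sub_distrib, Finset.sum_const, Finset.card_erase_of_mem (by simp),
      Finset.card_univ, nsmul_eq_mul, Nat.cast_sub Fintype.card_pos]
    have := mul_le_mul_of_nonneg_right hge (hpos x).le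
    push_cast
    linarith
  have h3 := (Finset.sum_eq_zero_iff_of_nonneg fun u _ => sub_nonneg.2 (hx u)).1
    (le_antisymm h2 (Finset.sum_nonneg fun u _ => sub_nonneg.2 (hx u)))
  refine hnonreg ⟨G.degree x, fun y => degree_eq_of_sq hdiag ?_⟩
  by_cases hyx : y = x
  · rw [hyx]
  · linarith [h3 y (by simpa using hyx)]

lemma eq_of_not_adj
    (hpos : ∀ x, 0 < α x) (hp : 0 ≤ θ1 * θ2) (hdiag : ∀ x, (G.degree x : ℝ) + θ1 * θ2 = α x ^ 2)
    (hnon : ∀ x y, x ≠ y → ¬ G.Adj x y →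
      ((G.neighborFinset x ∩ G.neighborFinset y).card : ℝ) = α x * α y)
    {x y : V} (hxy : ¬ G.Adj x y) : α x = α y := by
  have key : ∀ x y, x ≠ y → ¬ G.Adj x y → α x ≤ α y := fun x y hne h => by
    have h1 : ((G.neighborFinset x ∩ G.neighborFinset y).card : ℝ) ≤ G.degree y := by
      exact_mod_cast card_common_le_degree x y
    rw [hnon x y hne h] at h1
    have := hdiag y
    refine le_of_mul_le_mul_right (a := α y) ?_ (hpos y)
    nlinarith
  by_cases hne : x = y
  · rw [hne]
  · exact le_antisymm (key x y hne hxy) (key y x (Ne.symm hne) fun h => hxy h.symm)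

lemma zero_lt_of_nonbipartite (hG : G.Connected) (hnonbip : ¬ G.Colorable 2)
    (hnonreg : ¬ ∃ k, G.IsRegularOfDegree k) (h12 : θ1 > θ2)
    (hpos : ∀ x, 0 < α x) (hdiag : ∀ x, (G.degree x : ℝ) + θ1 * θ2 = α x ^ 2)
    (hadj : ∀ x y, G.Adj x y → ((G.neighborFinset x ∩ G.neighborFinset y).card : ℝ) =
      θ1 + θ2 + α x * α y)
    (hnon : ∀ x y, x ≠ y → ¬ G.Adj x y →
      ((G.neighborFinset x ∩ G.neighborFinset y).card : ℝ) = α x * α y) : 0 < θ1 := by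
  by_contra! hle
  have hp : 0 ≤ θ1 * θ2 := by nlinarith
  have heq : ∀ {x y}, ¬ G.Adj x y → α x = α y := eq_of_not_adj hpos hp hdiag hnon
  have hzero : θ1 = 0 := by
    obtain ⟨x, y, hne, hxy⟩ := exists_not_adj_of_not_regular hnonreg
    have h1 : ((G.neighborFinset x ∩ G.neighborFinset y).card : ℝ) ≤ G.degree y := by
      exact_mod_cast card_common_le_degree x y
    rw [hnon x y hne hxy, heq hxy] at h1
    nlinarith [hdiag y]
  subst hzero
  have hd : ∀ x, (G.degree x : ℝ) = α x ^ 2 := fun x => by simpa using hdiag x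
  have htwin : ∀ x y, ¬ G.Adj x y → G.neighborFinset x = G.neighborFinset y := by
    have hsub : ∀ x y, x ≠ y → ¬ G.Adj x y → G.neighborFinset y ⊆ G.neighborFinset x := by
      intro x y hne hxy
      have h1 : (G.neighborFinset x ∩ G.neighborFinset y).card = (G.neighborFinset y).card := by
        have := hnon x y hne hxy
        rw [heq hxy, ← sq, ← hd y] at this
        rw [SimpleGraph.card_neighborFinset_eq_degree]
        exact_mod_cast this
      exact Finset.inter_eq_right.1 (Finset.eq_of_subset_of_card_le Finset.inter_subset_right h1.ge)
    intro x y hxy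
    by_cases hne : x = y
    · rw [hne]
    · exact (hsub y x (Ne.symm hne) fun h => hxy h.symm).antisymm (hsub x y hne hxy)
  have hadj_of : ∀ {x y z}, G.Adj x y → ¬ G.Adj z x → G.Adj z y := fun {x y z} h hz => by
    have : y ∈ G.neighborFinset z := by rw [htwin z x hz]; simpa using h
    simpa using this
  have hform : ∀ x y, G.Adj x y → α x ^ 2 + α y ^ 2 - Fintype.card V = θ2 + α x * α y := by
    intro x y hxy
    have h1 := hadj x y hxy
    have hunion : G.neighborFinset x ∪ G.neighborFinset y = Finset.univ := by
      ext z
      simp only [Finset.mem_union, SimpleGraph.mem_neighborFinset, Finset.mem_univ, iff_true]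
      by_cases hz : G.Adj z x
      · exact Or.inl hz.symm
      · exact Or.inr (hadj_of hxy hz).symm
    have h2 := Finset.card_union_add_card_inter (G.neighborFinset x) (G.neighborFinset y)
    rw [hunion, Finset.card_univ, SimpleGraph.card_neighborFinset_eq_degree,
      SimpleGraph.card_neighborFinset_eq_degree] at h2
    have h3 : (Fintype.card V : ℝ) + ((G.neighborFinset x ∩ G.neighborFinset y).card : ℝ) =
      G.degree x + G.degree y := by exact_mod_cast h2
    rw [hd, hd, h1] at h3
    linarith
  have := hG.nonempty
  obtain ⟨x, y, hne⟩ := exists_degree_ne_of_not_regular hnonreg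
  have hα : α x ≠ α y := fun h => hne (degree_eq_of_sq hdiag h)
  have hxy : G.Adj x y := by
    by_contra h
    exact hα (heq h)
  obtain ⟨z, hzx, hzy⟩ : ∃ z, G.Adj z x ∧ G.Adj z y := by
    by_contra! hno
    refine hnonbip ⟨SimpleGraph.Coloring.mk (fun v => if G.Adj v x then 0 else 1) ?_⟩
    intro u v huv
    split_ifs with hu hv hv
    · exact absurd (hadj_of huv.symm (z := y) fun h => hno v hv h.symm) fun h => hno u hu h.symm
    · simp
    · simp
    · exact absurd (hadj_of huv (z := x) fun h => hu h.symm) fun h => hv h.symm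
  have e1 := hform x y hxy
  have e2 := hform z x hzx
  have e3 := hform z y hzy
  have f1 : (α x - α y) * (α x + α y - α z) = 0 := by linarith
  have f2 : (α z - α y) * (α z + α y - α x) = 0 := by linarith
  have p1 := hpos x
  have p2 := hpos y
  have p3 := hpos z
  have g1 : α z = α x + α y := by
    rcases mul_eq_zero.1 f1 with h | h
    · exact absurd (sub_eq_zero.1 h) hα
    · linarith
  rcases mul_eq_zero.1 f2 with h | h <;> linarith

end

section
variable {V : Type*} [Fintype V] [DecidableEq V] {G : SimpleGraph V} [DecidableRel G.Adj]

lemma eq_two_and_eq_five_of_sq_eq {N d D : ℤ} (hd : 2 ≤ d) (hN0 : 0 ≤ N) (hN : N ≤ d)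
    (hdD : d < D) (h : N ^ 2 = (D - 1) * (d - 1)) : d = 2 ∧ D = 5 := by
  have hNd : N = d := by
    refine le_antisymm hN ?_
    by_contra! hlt
    nlinarith
  subst hNd
  have h1 : (N - 1) * (D - N - 2) = 1 := by linarith
  rcases Int.eq_one_or_neg_one_of_mul_eq_one h1 with h2 | h2
  · rw [h2] at h1
    omega
  · omega

lemma not_golden_eigenvalues [Nonempty V] {α : V → ℝ} {θ : ℝ}
    (hnonreg : ¬ ∃ k, G.IsRegularOfDegree k)
    (hpos : ∀ x, 0 < α x) (hdiag : ∀ x, (G.degree x : ℝ) + -1 = α x ^ 2)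
    (hadj : ∀ x y, G.Adj x y → ((G.neighborFinset x ∩ G.neighborFinset y).card : ℝ) =
      -1 + α x * α y)
    (hnon : ∀ x y, x ≠ y → ¬ G.Adj x y →
      ((G.neighborFinset x ∩ G.neighborFinset y).card : ℝ) = α x * α y)
    (hα : ∀ x, ∑ u ∈ G.neighborFinset x, α u = θ * α x)
    (hcard : (Fintype.card V : ℝ) = 2 * θ + 1) (hsum : α ⬝ᵥ α = θ ^ 2 + θ - 1) : False := by
  have hdeg : ∀ x, 2 ≤ G.degree x := fun x => by
    have h1 := hdiag x
    have h2 := pow_pos (hpos x) 2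
    have h3 : (1 : ℝ) < G.degree x := by linarith
    exact_mod_cast h3
  have hlt : ∀ x y, G.degree y < G.degree x → G.degree y = 2 ∧ G.degree x = 5 := by
    intro x y hxy
    obtain ⟨N, hN, hNd⟩ : ∃ N : ℕ, (N : ℝ) = α x * α y ∧ N ≤ G.degree y := by
      by_cases h : G.Adj x y
      · refine ⟨_ + 1, ?_, card_common_add_one_le_degree h⟩
        push_cast
        rw [hadj x y h]
        ring
      · refine ⟨_, hnon x y ?_ h, card_common_le_degree x y⟩
        rintro rfl
        exact hxy.false
    have hsq : (N : ℤ) ^ 2 = ((G.degree x : ℤ) - 1) * ((G.degree y : ℤ) - 1) := by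
      have : (N : ℝ) ^ 2 = ((G.degree x : ℝ) - 1) * ((G.degree y : ℝ) - 1) := by
        rw [hN, mul_pow, ← hdiag, ← hdiag]
        ring
      exact_mod_cast this
    have := eq_two_and_eq_five_of_sq_eq (by exact_mod_cast hdeg y) (Int.natCast_nonneg N)
      (by exact_mod_cast hNd) (by exact_mod_cast hxy) hsq
    exact_mod_cast this
  obtain ⟨x, y, hx, hy⟩ : ∃ x y, G.degree x = 5 ∧ G.degree y = 2 := by
    obtain ⟨x, y, hne⟩ := exists_degree_ne_of_not_regular hnonreg
    rcases hne.lt_or_gt with h | h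
    · exact ⟨y, x, (hlt y x h).2, (hlt y x h).1⟩
    · exact ⟨x, y, (hlt x y h).2, (hlt x y h).1⟩
  have hall : ∀ z, G.degree z = 2 ∨ G.degree z = 5 := fun z => by
    rcases (hdeg z).eq_or_lt with h | h
    · exact Or.inl h.symm
    · exact Or.inr (hlt z y (hy ▸ h)).2
  have hval : ∀ z, α z = if G.degree z = 5 then 2 else 1 := fun z => by
    have h1 := hdiag z
    have h2 := hpos z
    rcases hall z with h | h <;> rw [h] at h1 ⊢ <;> norm_num at h1 ⊢ <;> nlinarith
  obtain ⟨u, v, huv, hN⟩ := Finset.card_eq_two.1 ((G.card_neighborFinset_eq_degree y).trans hy)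
  have hθ := hα y
  rw [hN, Finset.sum_pair huv, hval y, hy, if_neg (by norm_num), mul_one] at hθ
  have hb : α ⬝ᵥ α = Fintype.card V + 3 * (Finset.card {z | G.degree z = 5} : ℝ) := by
    have : ∀ z, α z * α z = 1 + 3 * (if G.degree z = 5 then 1 else 0) := fun z => by
      rw [hval]
      split_ifs <;> norm_num
    simp only [dotProduct, this]
    rw [Finset.sum_add_distrib, ← Finset.mul_sum, Finset.sum_boole]
    simp
  have hbpos : 0 < Finset.card {z | G.degree z = 5} := Finset.card_pos.2 ⟨x, by simpa using hx⟩
  generalize Finset.card {z | G.degree z = 5} = b at hb hbpos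
  rw [hsum, hcard, ← hθ, hval, hval] at hb
  split_ifs at hb
  · have : (10 : ℝ) = 3 * b := by linarith
    norm_cast at this
    omega
  · have : (4 : ℝ) = 3 * b := by linarith
    norm_cast at this
    omega
  · have : (4 : ℝ) = 3 * b := by linarith
    norm_cast at this
    omega
  · have : (0 : ℝ) = 3 * b := by linarith
    norm_cast at this
    omega

end
end

/-- A connected, nonbipartite, nonregular finite simple graph with exactly three distinct
adjacency eigenvalues θ0 > θ1 > θ2 and θ1 ≤ 1 has θ1 = 1 and θ0, θ2 integers. -/
theorem nonbipartite_nonregular_integral_eigenvalues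
    {V : Type} [Fintype V] [DecidableEq V] (Γ : SimpleGraph V) [DecidableRel Γ.Adj]
    (θ0 θ1 θ2 : ℝ)
    (hconn : Γ.Connected)
    (hnonbip : ¬ Γ.Colorable 2)
    (hnonreg : ¬ ∃ k, Γ.IsRegularOfDegree k)
    (h01 : θ0 > θ1) (h12 : θ1 > θ2)
    (hspec : spectrum ℝ (Γ.adjMatrix ℝ) = {θ0, θ1, θ2})
    (hθ1 : θ1 ≤ 1) :
    θ1 = 1 ∧ (∃ z : ℤ, θ0 = (z : ℝ)) ∧ (∃ z : ℤ, θ2 = (z : ℝ)) := by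
  have := hconn.nonempty
  obtain ⟨α, hpos, hvec, huniq, hrank, hsum⟩ := exists_rank_one_decomposition hconn h01 h12 hspec
  have hα : ∀ x, ∑ u ∈ Γ.neighborFinset x, α u = θ0 * α x := fun x => by
    simpa [SimpleGraph.adjMatrix_mulVec_apply] using congrFun hvec x
  have hdiag : ∀ x, (Γ.degree x : ℝ) + θ1 * θ2 = α x ^ 2 := fun x => by
    simpa [sq] using rank_one_apply hrank x x
  have hadj : ∀ x y, Γ.Adj x y → ((Γ.neighborFinset x ∩ Γ.neighborFinset y).card : ℝ) =
      θ1 + θ2 + α x * α y := fun x y h => by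
    have := rank_one_apply hrank x y
    rw [SimpleGraph.adjMatrix_apply, if_pos h, Matrix.one_apply_ne h.ne] at this
    linarith
  have hnon : ∀ x y, x ≠ y → ¬ Γ.Adj x y →
      ((Γ.neighborFinset x ∩ Γ.neighborFinset y).card : ℝ) = α x * α y := fun x y hne h => by
    have := rank_one_apply hrank x y
    rw [SimpleGraph.adjMatrix_apply, if_neg h, Matrix.one_apply_ne hne] at this
    linarith
  have hθ1pos : 0 < θ1 :=
    zero_lt_of_nonbipartite hconn hnonbip hnonreg h12 hpos hdiag hadj hnon
  have hcard : 4 ≤ Fintype.card V := by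
    obtain ⟨x, y, hne, hxy⟩ := exists_not_adj_of_not_regular hnonreg
    exact four_le_card hnonbip hne hxy
  have hlt := lt_card_sub_one hconn hnonreg hpos hdiag hα
  have hA := SimpleGraph.isHermitian_adjMatrix ℝ Γ
  have hchar := charpoly_adjMatrix_map (G := Γ)
  obtain ⟨hmult, htrace⟩ := sum_rootMultiplicity_charpoly hA h01 h12 hspec
  have hone := rootMultiplicity_charpoly_eq_one hA (θ := θ0) (by rw [hspec]; simp) huniq
  rw [SimpleGraph.trace_adjMatrix, hone] at htrace
  rw [hone] at hmult
  have hS : ∀ t, t ∈ ({θ0, θ1, θ2} : Finset ℝ) ↔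
      Polynomial.aeval t (Γ.adjMatrix ℤ).charpoly = 0 := fun t => by
    have h := Matrix.mem_spectrum_iff_isRoot_charpoly (A := Γ.adjMatrix ℝ) (r := t)
    rw [hspec, ← hchar, Polynomial.IsRoot.def] at h
    simpa [Polynomial.aeval_def, Polynomial.eval_map] using h
  have hmonic := (Γ.adjMatrix ℤ).charpoly_monic
  have hprod : ∀ a ∈ ({θ0, θ1, θ2} : Finset ℝ), ∀ z : ℤ, ∃ w : ℤ,
      (if minpoly ℚ θ0 = minpoly ℚ a then (z : ℝ) - θ0 else 1) *
      ((if minpoly ℚ θ1 = minpoly ℚ a then (z : ℝ) - θ1 else 1) *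
      (if minpoly ℚ θ2 = minpoly ℚ a then (z : ℝ) - θ2 else 1)) = w := by
    intro a ha z
    have h := exists_int_prod_conjugates _ hmonic _ hS (hchar ▸ hA.splits_charpoly) ha z
    rwa [Finset.prod_filter, Finset.prod_insert (by simp [h01.ne', (h12.trans h01).ne']),
      Finset.prod_insert (by simp [h12.ne']), Finset.prod_singleton] at h
  have hmulteq : ∀ a ∈ ({θ0, θ1, θ2} : Finset ℝ), ∀ b, minpoly ℚ a = minpoly ℚ b →
      (Γ.adjMatrix ℝ).charpoly.rootMultiplicity a =
        (Γ.adjMatrix ℝ).charpoly.rootMultiplicity b := by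
    intro a ha b hab
    rw [← hchar]
    exact rootMultiplicity_eq_of_minpoly_eq _ ⟨_, hmonic, (hS a).1 ha⟩ hab
  have hm01 := hmulteq θ0 (by simp) θ1
  have hm02 := hmulteq θ0 (by simp) θ2
  have hm12 := hmulteq θ1 (by simp) θ2
  have hp0 := hprod θ0 (by simp)
  have hp1 := hprod θ1 (by simp)
  have hp2 := hprod θ2 (by simp)
  rw [hone] at hm01 hm02
  generalize (Γ.adjMatrix ℝ).charpoly.rootMultiplicity θ1 = m1 at *
  generalize (Γ.adjMatrix ℝ).charpoly.rootMultiplicity θ2 = m2 at *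
  have hcardR : (Fintype.card V : ℝ) = 1 + m1 + m2 := by exact_mod_cast hmult.symm
  have hcard4 : (4 : ℝ) ≤ 1 + m1 + m2 := by rw [← hcardR]; exact_mod_cast hcard
  rw [hcardR] at hlt
  push_cast at htrace
  have hint0 : minpoly ℚ θ1 ≠ minpoly ℚ θ0 → minpoly ℚ θ2 ≠ minpoly ℚ θ0 → ∃ z : ℤ, θ0 = z := by
    intro h1 h2
    obtain ⟨w, hw⟩ := hp0 0
    rw [if_pos rfl, if_neg h1, if_neg h2] at hw
    exact ⟨-w, by push_cast at hw ⊢; linarith⟩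
  have hint2 : minpoly ℚ θ0 ≠ minpoly ℚ θ2 → minpoly ℚ θ1 ≠ minpoly ℚ θ2 → ∃ z : ℤ, θ2 = z := by
    intro h1 h2
    obtain ⟨w, hw⟩ := hp2 0
    rw [if_pos rfl, if_neg h1, if_neg h2] at hw
    exact ⟨-w, by push_cast at hw ⊢; linarith⟩
  by_cases c01 : minpoly ℚ θ0 = minpoly ℚ θ1 <;> by_cases c12 : minpoly ℚ θ1 = minpoly ℚ θ2
  · have := hm01 c01
    have := hm12 c12
    omega
  · obtain ⟨t, rfl⟩ := hint2 (c01 ▸ c12) c12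
    have hm1' := hm01 c01
    subst hm1'
    push_cast at hcard4 htrace hlt
    have ht1 : t < 0 := by
      by_contra! h
      have : (0 : ℝ) ≤ t := by exact_mod_cast h
      nlinarith
    have ht2 : -2 < t := by
      by_contra! h
      have : (t : ℝ) ≤ -2 := by exact_mod_cast h
      nlinarith
    obtain rfl : t = -1 := by omega
    push_cast at hdiag hadj
    exact absurd (regular_of_eq_neg_one hconn hpos hdiag hadj) hnonreg
  · have hm := hm12 c12
    subst hm
    have hz0 := hint0 (Ne.symm c01) (c12 ▸ Ne.symm c01)
    obtain ⟨p, hp⟩ := hp1 0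
    obtain ⟨q, hq⟩ := hp1 1
    rw [if_neg c01, if_pos rfl, if_pos c12.symm] at hp hq
    push_cast at hp hq
    obtain ⟨s, hs⟩ : ∃ s : ℤ, θ1 + θ2 = s := ⟨1 + p - q, by push_cast; linarith⟩
    have hθ0 : θ0 = -(m1 * s) := by rw [← hs]; linarith
    have hs1 : s < 0 := by
      by_contra! h
      have : (0 : ℝ) ≤ s := by exact_mod_cast h
      nlinarith
    have hs2 : -2 < s := by
      by_contra! h
      have : (s : ℝ) ≤ -2 := by exact_mod_cast h
      nlinarith
    obtain rfl : s = -1 := by omega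
    push_cast at hs hθ0
    obtain rfl : θ2 = -1 - θ1 := by linarith
    have hp1 : p < 0 := by
      have : (p : ℝ) < 0 := by nlinarith
      exact_mod_cast this
    have hp2 : -3 < p := by
      have : (-3 : ℝ) < p := by nlinarith
      exact_mod_cast this
    obtain rfl | rfl : p = -2 ∨ p = -1 := by omega
    · have : θ1 = 1 := by push_cast at hp; nlinarith
      subst this
      exact ⟨rfl, hz0, -2, by norm_num⟩
    · push_cast at hp
      have hmul : θ1 * (-1 - θ1) = -1 := by linarith
      rw [hmul] at hdiag
      rw [hs] at hadj
      refine (not_golden_eigenvalues (θ := θ0) hnonreg hpos hdiag hadj hnon hα ?_ ?_).elim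
      · rw [hcardR, hθ0]; ring
      · rw [hsum]; linarith
  · obtain ⟨w, hw⟩ := hp1 0
    rw [if_neg c01, if_pos rfl, if_neg (Ne.symm c12)] at hw
    push_cast at hw
    have hw1 : w < 0 := by
      have : (w : ℝ) < 0 := by linarith
      exact_mod_cast this
    have hw2 : -1 ≤ w := by
      have : (-1 : ℝ) ≤ w := by linarith
      exact_mod_cast this
    obtain rfl : w = -1 := by omega
    obtain rfl : θ1 = 1 := by push_cast at hw; linarith
    by_cases c02 : minpoly ℚ θ0 = minpoly ℚ θ2
    · have hm2 := hm02 c02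
      subst hm2
      have := perron_add_mul_pos hpos hdiag hα
      push_cast at htrace hcard4
      linarith
    · exact ⟨rfl, hint0 (Ne.symm c01) (Ne.symm c02), hint2 c02 c12⟩
end

section
/- Let Γ be a connected finite simple graph whose adjacency matrix has exactly three distinct eigenvalues θ0 > 1 > θ2 (second largest eigenvalue equal to 1). Then there exists a natural number ω ≥ 1 such that for every vertex v of Γ there exists a natural number β_v with d_v + θ2 = ω·β_v², where d_v denotes the degree of v. -/
open Matrix

namespace Matrix

variable {V : Type*} [Fintype V] [DecidableEq V] {A : Matrix V V ℝ}

theorem IsHermitian.mul_sub_eq_zero_of_spectrum_eq (hA : A.IsHermitian) {a b c : ℝ}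
    (h : spectrum ℝ A = {a, b, c}) :
    (A - a • 1) * ((A - b • 1) * (A - c • 1)) = 0 := by
  have h1 := cfc_polynomial (R := ℝ) ((Polynomial.X - Polynomial.C a) *
    ((Polynomial.X - Polynomial.C b) * (Polynomial.X - Polynomial.C c))) A hA
  rw [cfc_congr (g := fun _ => 0)] at h1
  · simpa [Algebra.algebraMap_eq_smul_one] using h1.symm
  · intro x hx
    rw [h] at hx
    rcases hx with rfl | rfl | rfl <;> simp

theorem IsHermitian.posSemidef_smul_one_sub_s3 (hA : A.IsHermitian) {t : ℝ}
    (h : ∀ x ∈ spectrum ℝ A, x ≤ t) : (t • 1 - A).PosSemidef := by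
  rw [posSemidef_iff_isHermitian_and_spectrum_nonneg]
  refine ⟨IsHermitian.sub (by ext i j; simp [one_apply, eq_comm]) hA, ?_⟩
  rw [← Algebra.algebraMap_eq_smul_one, ← spectrum.singleton_sub_eq]
  intro x hx
  rw [Set.singleton_sub, Set.mem_image] at hx
  obtain ⟨y, hy, rfl⟩ := hx
  simpa using h y hy

end Matrix

namespace SimpleGraph

theorem adjMatrix_map_natCast {V : Type*} (Γ : SimpleGraph V) [DecidableRel Γ.Adj] (R : Type*) [NonAssocSemiring R] :
    (Γ.adjMatrix ℕ).map (Nat.castRingHom R) = Γ.adjMatrix R := by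
  ext i j
  simp [adjMatrix_apply]

variable {V : Type*} [Fintype V] (Γ : SimpleGraph V) [DecidableRel Γ.Adj]

theorem adjMatrix_mul_self_apply_natCast (R : Type*) [NonAssocSemiring R] (i j : V) :
    (Γ.adjMatrix R * Γ.adjMatrix R) i j = ((Γ.adjMatrix ℕ * Γ.adjMatrix ℕ) i j : ℕ) := by
  rw [← Γ.adjMatrix_map_natCast R, ← Matrix.map_mul]
  rfl

theorem isIntegral_of_mem_spectrum_adjMatrix [DecidableEq V] {t : ℝ}
    (h : t ∈ spectrum ℝ (Γ.adjMatrix ℝ)) : IsIntegral ℤ t := by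
  refine ⟨(Γ.adjMatrix ℤ).charpoly, charpoly_monic _, ?_⟩
  rw [mem_spectrum_iff_isRoot_charpoly, Polynomial.IsRoot] at h
  have hmap : (Γ.adjMatrix ℤ).map (algebraMap ℤ ℝ) = Γ.adjMatrix ℝ := by
    ext i j
    simp [adjMatrix_apply]
  rw [← Polynomial.eval_map, ← charpoly_map, hmap]
  exact h

theorem exists_le_degree_of_mem_spectrum_adjMatrix [DecidableEq V] {t : ℝ}
    (h : t ∈ spectrum ℝ (Γ.adjMatrix ℝ)) : ∃ v, t ≤ Γ.degree v := by
  rw [← spectrum_toLin', ← Module.End.hasEigenvalue_iff_mem_spectrum] at h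
  obtain ⟨k, hk⟩ := eigenvalue_mem_ball h
  refine ⟨k, ?_⟩
  have hsum : ∑ j ∈ Finset.univ.erase k, ‖Γ.adjMatrix ℝ k j‖ ≤ Γ.degree k := by
    calc _ ≤ ∑ j, ‖Γ.adjMatrix ℝ k j‖ :=
          Finset.sum_le_sum_of_subset_of_nonneg (Finset.subset_univ _)
            fun _ _ _ => norm_nonneg _
      _ = ∑ j, Γ.adjMatrix ℝ k j := by
          refine Finset.sum_congr rfl fun j _ => ?_
          rw [adjMatrix_apply]
          split_ifs <;> simp
      _ = Γ.degree k := by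
          have := Γ.adjMatrix_mulVec_const_apply (α := ℝ) (a := 1) (v := k)
          simpa [mulVec, dotProduct] using this
  rw [Metric.mem_closedBall, Real.dist_eq, adjMatrix_apply] at hk
  simp only [SimpleGraph.irrefl, if_false, sub_zero] at hk
  exact (le_abs_self t).trans (hk.trans hsum)

variable {Γ}

/-- An eigenvector for the largest adjacency eigenvalue of a connected graph has no zero entry. -/
theorem Connected.eq_zero_of_mulVec_eq_smul [DecidableEq V] (hconn : Γ.Connected) {t : ℝ}
    (ht : (t • 1 - Γ.adjMatrix ℝ).PosSemidef) {x : V → ℝ} (hx : Γ.adjMatrix ℝ *ᵥ x = t • x)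
    {v : V} (hv : x v = 0) : x = 0 := by
  have hker : Γ.adjMatrix ℝ *ᵥ |x| = t • |x| := by
    have h0 : star |x| ⬝ᵥ (t • 1 - Γ.adjMatrix ℝ) *ᵥ |x| = 0 := by
      refine le_antisymm ?_ (ht.dotProduct_mulVec_nonneg _)
      have hx0 : x ⬝ᵥ (t • 1 - Γ.adjMatrix ℝ) *ᵥ x = 0 := by
        simp [sub_mulVec, smul_mulVec, hx]
      rw [← hx0, star_trivial]
      simp only [sub_mulVec, smul_mulVec, one_mulVec, dotProduct_sub]
      refine sub_le_sub (le_of_eq ?_) ?_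
      · simp only [dotProduct, Pi.smul_apply, smul_eq_mul, Pi.abs_apply]
        refine Finset.sum_congr rfl fun i _ => ?_
        linear_combination t * abs_mul_abs_self (x i)
      · simp only [dotProduct, adjMatrix_mulVec_apply, Finset.mul_sum, Pi.abs_apply]
        refine Finset.sum_le_sum fun i _ => Finset.sum_le_sum fun j _ => ?_
        rw [← abs_mul]
        exact le_abs_self _
    rw [ht.dotProduct_mulVec_zero_iff, sub_mulVec, smul_mulVec, one_mulVec, sub_eq_zero] at h0
    exact h0.symm
  have hstep : ∀ u w, Γ.Adj u w → x u = 0 → x w = 0 := by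
    intro u w huw hu
    have h := congrFun hker u
    rw [adjMatrix_mulVec_apply, Pi.smul_apply, Pi.abs_apply, hu, abs_zero, smul_zero,
      Finset.sum_eq_zero_iff_of_nonneg (fun i _ => (abs_nonneg x : 0 ≤ |x|) i)] at h
    simpa using h w (by simpa using huw)
  ext w
  obtain ⟨p⟩ := hconn.preconnected v w
  induction p with
  | nil => exact hv
  | cons h _ ih => exact ih (hstep _ _ h hv)

theorem Connected.mul_eq_mul_of_mulVec_eq_smul [DecidableEq V] (hconn : Γ.Connected) {t : ℝ}
    (ht : (t • 1 - Γ.adjMatrix ℝ).PosSemidef) {x y : V → ℝ}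
    (hx : Γ.adjMatrix ℝ *ᵥ x = t • x) (hy : Γ.adjMatrix ℝ *ᵥ y = t • y) (v w : V) :
    y v * x w = x v * y w := by
  have h := hconn.eq_zero_of_mulVec_eq_smul ht (x := y v • x - x v • y) (v := v)
    (by rw [mulVec_sub, mulVec_smul, mulVec_smul, hx, hy, smul_sub, smul_comm t, smul_comm t])
    (by simp [mul_comm])
  simpa [sub_eq_zero] using congrFun h w

end SimpleGraph

theorem exists_eq_mul_sq_of_mul_eq_sq {ι : Type*} (a : ι → ℕ)
    (h : ∀ i j, ∃ m, a i * a j = m ^ 2) : ∃ ω, 1 ≤ ω ∧ ∀ i, ∃ β, a i = ω * β ^ 2 := by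
  by_cases h0 : ∀ i, a i = 0
  · exact ⟨1, le_rfl, fun i => ⟨0, by simp [h0 i]⟩⟩
  push Not at h0
  obtain ⟨j, hj⟩ := h0
  obtain ⟨ω, b, hb, hω⟩ := Nat.sq_mul_squarefree (a j)
  have hb0 : b ≠ 0 := by rintro rfl; simp at hb; omega
  refine ⟨ω, Nat.one_le_iff_ne_zero.2 hω.ne_zero, fun i => ?_⟩
  obtain ⟨m, hm⟩ := h i j
  obtain ⟨k, rfl⟩ : b ∣ m := by
    rw [← Nat.pow_dvd_pow_iff two_ne_zero, ← hm, ← hb]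
    exact Dvd.intro (ω * a i) (by ring)
  have hk : a i * ω = k ^ 2 := by
    refine Nat.eq_of_mul_eq_mul_left (pow_pos (Nat.pos_of_ne_zero hb0) 2) ?_
    rw [← mul_pow, ← hm, ← hb]
    ring
  obtain ⟨l, rfl⟩ : ω ∣ k := by
    rw [← hω.dvd_pow_iff_dvd two_ne_zero, ← hk]
    exact Dvd.intro_left _ rfl
  refine ⟨l, Nat.eq_of_mul_eq_mul_right (Nat.pos_of_ne_zero hω.ne_zero) ?_⟩
  rw [hk]
  ring

/-- For a connected finite simple graph with exactly three distinct adjacency eigenvalues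
θ0 > 1 > θ2, there is a natural number ω ≥ 1 such that every vertex v satisfies
d_v + θ2 = ω·β_v² for some natural number β_v. -/
theorem squarefree_part_of_degrees
    {V : Type} [Fintype V] [DecidableEq V] (Γ : SimpleGraph V) [DecidableRel Γ.Adj]
    (θ0 θ2 : ℝ)
    (hconn : Γ.Connected)
    (h01 : θ0 > 1) (h12 : (1 : ℝ) > θ2)
    (hspec : spectrum ℝ (Γ.adjMatrix ℝ) = {θ0, 1, θ2}) :
    ∃ ω : ℕ, 1 ≤ ω ∧ ∀ v : V, ∃ β : ℕ, (Γ.degree v : ℝ) + θ2 = (ω : ℝ) * (β : ℝ) ^ 2 := by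
  set A := Γ.adjMatrix ℝ with hAdef
  set N := Γ.adjMatrix ℕ * Γ.adjMatrix ℕ with hN
  have hA : A.IsHermitian := by
    ext i j
    simp [hAdef, SimpleGraph.adjMatrix_apply, SimpleGraph.adj_comm]
  have hpsd : (θ0 • 1 - A).PosSemidef := by
    refine hA.posSemidef_smul_one_sub_s3 fun x hx => ?_
    rw [hspec] at hx
    rcases hx with rfl | rfl | rfl <;> linarith
  set M := (A - (1 : ℝ) • 1) * (A - θ2 • 1) with hM
  have hAM : A * M = θ0 • M := by
    have := hA.mul_sub_eq_zero_of_spectrum_eq hspec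
    rwa [sub_mul, smul_mul_assoc, one_mul, sub_eq_zero] at this
  have hM' : M = A * A - (1 + θ2) • A + θ2 • 1 := by
    simp only [hM, one_smul, sub_mul, mul_sub, one_mul, mul_smul_comm, mul_one]
    module
  have hMapply : ∀ i j, M i j =
      N i j - (1 + θ2) * (if Γ.Adj i j then 1 else 0) + θ2 * (if i = j then 1 else 0) := by
    intro i j
    rw [hM', hN, ← Γ.adjMatrix_mul_self_apply_natCast ℝ]
    simp [hAdef, SimpleGraph.adjMatrix_apply, Matrix.one_apply]
  have hMdiag : ∀ i, M i i = Γ.degree i + θ2 := by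
    intro i
    rw [hMapply, hN, SimpleGraph.adjMatrix_mul_self_apply_self]
    simp
  have hcol : ∀ j, A *ᵥ M.col j = θ0 • M.col j := by
    intro j
    ext i
    exact congrFun (congrFun hAM i) j
  have hMsymm : ∀ i j, M j i = M i j := by
    have hT : Mᵀ = M := by
      have : Aᵀ = A := Γ.transpose_adjMatrix
      rw [hM']
      simp [this]
    intro i j
    exact congrFun (congrFun hT i) j
  have hrank : ∀ i j, M i i * M j j = M i j ^ 2 := by
    intro i j
    have := hconn.mul_eq_mul_of_mulVec_eq_smul hpsd (hcol j) (hcol i) i j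
    simp only [Matrix.col_apply] at this
    rw [this, hMsymm i j, sq]
  have hnonneg : ∀ i, 0 ≤ M i i := by
    intro i
    have hMM : M * M = ((θ0 - 1) * (θ0 - θ2)) • M := by
      nth_rewrite 1 [hM']
      rw [add_mul, sub_mul, mul_assoc, smul_mul_assoc, hAM, mul_smul_comm, hAM,
        smul_mul_assoc, one_mul]
      module
    have h1 : 0 ≤ (M * M) i i := by
      rw [Matrix.mul_apply]
      refine Finset.sum_nonneg fun j _ => ?_
      rw [hMsymm i j]
      exact mul_self_nonneg _
    rw [hMM, Matrix.smul_apply, smul_eq_mul] at h1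
    exact nonneg_of_mul_nonneg_right h1 (mul_pos (by linarith) (by linarith))
  obtain ⟨t, rfl⟩ : ∃ t : ℤ, (t : ℝ) = θ2 := by
    obtain ⟨v, hv⟩ := Γ.exists_le_degree_of_mem_spectrum_adjMatrix (t := θ0)
      (by simp [← hAdef, hspec])
    have hdv : 1 < Γ.degree v := by exact_mod_cast h01.trans_le hv
    obtain ⟨w, hw⟩ := (Γ.degree_pos_iff_exists_adj v).1 (by omega)
    have hdw : 0 < Γ.degree w := (Γ.degree_pos_iff_exists_adj w).2 ⟨v, hw.symm⟩
    have hvw := hrank v w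
    rw [hMdiag, hMdiag, hMapply] at hvw
    simp only [hw, hw.ne, if_true, if_false] at hvw
    obtain ⟨q, hq⟩ : ∃ q : ℚ, (q : ℝ) = θ2 := by
      have hne : (Γ.degree v + Γ.degree w + 2 * N v w - 2 : ℝ) ≠ 0 := by
        have h2 : (1 : ℝ) < Γ.degree v := by exact_mod_cast hdv
        have h3 : (1 : ℝ) ≤ Γ.degree w := by exact_mod_cast hdw
        have h4 : (0 : ℝ) ≤ N v w := Nat.cast_nonneg _
        linarith
      refine ⟨((N v w - 1) ^ 2 - Γ.degree v * Γ.degree w) /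
        (Γ.degree v + Γ.degree w + 2 * N v w - 2), ?_⟩
      push_cast
      rw [div_eq_iff hne]
      linear_combination -hvw
    have hθ2int : IsIntegral ℤ θ2 :=
      Γ.isIntegral_of_mem_spectrum_adjMatrix (by simp [← hAdef, hspec])
    rw [← hq] at hθ2int
    obtain ⟨t, ht⟩ := IsIntegrallyClosed.isIntegral_iff.1
      ((isIntegral_algebraMap_iff (algebraMap ℚ ℝ).injective).1 hθ2int)
    exact ⟨t, by rw [← hq, ← ht]; simp⟩
  have hMint : ∀ i j, ∃ m : ℤ, M i j = m := by
    intro i j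
    refine ⟨N i j - (1 + t) * (if Γ.Adj i j then 1 else 0) + t * (if i = j then 1 else 0), ?_⟩
    rw [hMapply]
    push_cast
    rfl
  choose m hm using hMint
  have hmdiag : ∀ i, ((m i i).natAbs : ℝ) = Γ.degree i + t := by
    intro i
    rw [← hMdiag, Nat.cast_natAbs, Int.cast_abs, ← hm, abs_of_nonneg (hnonneg i)]
  obtain ⟨ω, hω, h⟩ := exists_eq_mul_sq_of_mul_eq_sq (fun i => (m i i).natAbs) fun i j => by
    refine ⟨(m i j).natAbs, ?_⟩
    rw [← Int.natAbs_mul, ← Int.natAbs_pow]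
    congr 1
    have := hrank i j
    simp only [hm] at this
    exact_mod_cast this
  refine ⟨ω, hω, fun v => ?_⟩
  obtain ⟨β, hβ⟩ := h v
  exact ⟨β, by rw [← hmdiag]; exact_mod_cast hβ⟩
end

section
/- Let Γ be an n-vertex connected finite simple graph whose adjacency matrix has exactly three distinct eigenvalues θ0 > θ1 > θ2, which is a cone (has a vertex of degree n−1) and which has exactly three distinct vertex degrees. Set A := −θ1·θ2 and B := −θ1 − θ2 − 1. Then: (a) 5A + 4B + 1 < n ≤ (A+B+1)² + A + 1; (b) if B > 0 then n ≤ (A+B)²/B + 3(A+B) + 1; (c) θ0² − (n − 2 − A − B)·θ0 − (n−1)(1 − A − B) = 0; (d) n ≥ 3(A+B) + √(8(A+B)(A+B−1)). -/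
section

open scoped Matrix

open Polynomial in
/-- A real symmetric matrix with spectrum in `{a, b, c}` is annihilated by
`(X - a) (X - b) (X - c)`. -/
theorem Matrix.IsHermitian.mul_sub_eq_zero_of_spectrum_subset {V : Type*} [Fintype V]
    [DecidableEq V] {M : Matrix V V ℝ} (hM : M.IsHermitian) {a b c : ℝ}
    (hspec : spectrum ℝ M ⊆ {a, b, c}) :
    (M - a • 1) * ((M - b • 1) * (M - c • 1)) = 0 := by
  have hM' : IsSelfAdjoint M := hM
  have h := cfc_polynomial ((X - C a) * ((X - C b) * (X - C c))) M hM'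
  rw [cfc_congr (g := 0) (fun x hx => by
    rcases hspec hx with h | h | h <;> simp_all)] at h
  simpa [Algebra.algebraMap_eq_smul_one] using h.symm

theorem Matrix.exists_mulVec_eq_smul_of_mem_spectrum {V : Type*} [Fintype V]
    [DecidableEq V] {M : Matrix V V ℝ} {r : ℝ} (h : r ∈ spectrum ℝ M) :
    ∃ u : V → ℝ, u ≠ 0 ∧ M *ᵥ u = r • u := by
  rw [spectrum.mem_iff, Matrix.isUnit_iff_isUnit_det, isUnit_iff_ne_zero, not_not,
    ← Matrix.exists_mulVec_eq_zero_iff] at h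
  obtain ⟨u, hu, h⟩ := h
  refine ⟨u, hu, ?_⟩
  rw [Matrix.sub_mulVec, Algebra.algebraMap_eq_smul_one, Matrix.smul_mulVec,
    Matrix.one_mulVec, sub_eq_zero] at h
  exact h.symm

theorem Matrix.IsHermitian.posSemidef_smul_one_sub_s5 {V : Type*} [Fintype V]
    [DecidableEq V] {M : Matrix V V ℝ} (hM : M.IsHermitian) {r : ℝ}
    (h : ∀ x ∈ spectrum ℝ M, x ≤ r) : (r • 1 - M).PosSemidef := by
  rw [Matrix.posSemidef_iff_isHermitian_and_spectrum_nonneg]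
  refine ⟨(Matrix.isHermitian_one.smul (IsSelfAdjoint.all r)).sub hM, ?_⟩
  rw [← Algebra.algebraMap_eq_smul_one, ← spectrum.singleton_sub_eq]
  rintro _ ⟨_, rfl, x, hx, rfl⟩
  simpa using h x hx

namespace SimpleGraph

variable {V : Type*} [Fintype V] [DecidableEq V] {Γ : SimpleGraph V} [DecidableRel Γ.Adj]

theorem isHermitian_adjMatrix_real {W : Type*} {G : SimpleGraph W} [DecidableRel G.Adj] :
    (G.adjMatrix ℝ).IsHermitian := by
  rw [Matrix.IsHermitian, Matrix.conjTranspose_eq_transpose_of_trivial, transpose_adjMatrix]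

theorem adjMatrix_mulVec_abs {r : ℝ} (h : ∀ x ∈ spectrum ℝ (Γ.adjMatrix ℝ), x ≤ r) {u : V → ℝ}
    (hu : Γ.adjMatrix ℝ *ᵥ u = r • u) : Γ.adjMatrix ℝ *ᵥ |u| = r • |u| := by
  have hP := isHermitian_adjMatrix_real.posSemidef_smul_one_sub_s5 h
  have h0 := (hP.dotProduct_mulVec_zero_iff |u|).1 (by
    refine le_antisymm ?_ (hP.dotProduct_mulVec_nonneg _)
    have h1 : u ⬝ᵥ ((r • 1 - Γ.adjMatrix ℝ) *ᵥ u) = 0 := by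
      rw [Matrix.sub_mulVec, Matrix.smul_mulVec, Matrix.one_mulVec, hu, sub_self,
        dotProduct_zero]
    rw [← h1, star_trivial]
    simp only [Matrix.sub_mulVec, Matrix.smul_mulVec, Matrix.one_mulVec, dotProduct,
      Pi.sub_apply, Pi.smul_apply, adjMatrix_mulVec_apply, smul_eq_mul, Pi.abs_apply]
    refine Finset.sum_le_sum fun x _ => ?_
    have h2 : |u x| * (r * |u x|) = u x * (r * u x) := by
      rw [mul_left_comm, abs_mul_abs_self, mul_left_comm]
    have h3 : u x * ∑ w ∈ Γ.neighborFinset x, u w ≤ |u x| * ∑ w ∈ Γ.neighborFinset x, |u w| :=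
      (le_abs_self _).trans (by rw [abs_mul]; gcongr; exact Finset.abs_sum_le_sum_abs _ _)
    rw [mul_sub, mul_sub, h2]
    linarith)
  rw [Matrix.sub_mulVec, Matrix.smul_mulVec, Matrix.one_mulVec, sub_eq_zero] at h0
  exact h0.symm

theorem Connected.ne_zero_of_adjMatrix_mulVec_eq (hconn : Γ.Connected) {r : ℝ}
    (h : ∀ x ∈ spectrum ℝ (Γ.adjMatrix ℝ), x ≤ r) {u : V → ℝ} (hu0 : u ≠ 0)
    (hu : Γ.adjMatrix ℝ *ᵥ u = r • u) (x : V) : u x ≠ 0 := by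
  intro hx
  apply hu0
  have key : ∀ a b, Γ.Adj a b → u a = 0 → u b = 0 := by
    intro a b hab ha
    have h1 := congrFun (adjMatrix_mulVec_abs h hu) a
    simp only [adjMatrix_mulVec_apply, Pi.smul_apply, Pi.abs_apply, ha, abs_zero,
      smul_zero] at h1
    rw [Finset.sum_eq_zero_iff_of_nonneg (fun _ _ => abs_nonneg _)] at h1
    exact abs_eq_zero.1 (h1 b (by simpa using hab))
  funext y
  obtain ⟨p⟩ := hconn.preconnected x y
  induction p with
  | nil => exact hx
  | cons hab _ ih => exact ih (key _ _ hab hx)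

/-- A connected graph with three distinct eigenvalues satisfies
`(M - θ₁) (M - θ₂) = α αᵀ` for a positive eigenvector `α` of the largest eigenvalue. -/
theorem Connected.exists_pos_eigenvector_of_three_eigenvalues (hconn : Γ.Connected)
    {θ0 θ1 θ2 : ℝ} (h01 : θ1 < θ0) (h12 : θ2 < θ1)
    (hspec : spectrum ℝ (Γ.adjMatrix ℝ) = {θ0, θ1, θ2}) :
    ∃ α : V → ℝ, (∀ x, 0 < α x) ∧ Γ.adjMatrix ℝ *ᵥ α = θ0 • α ∧
      (Γ.adjMatrix ℝ - θ1 • 1) * (Γ.adjMatrix ℝ - θ2 • 1) = Matrix.vecMulVec α α := by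
  set M := Γ.adjMatrix ℝ with hMdef
  have hM : M.IsHermitian := isHermitian_adjMatrix_real
  have hle : ∀ x ∈ spectrum ℝ M, x ≤ θ0 := by
    rw [hspec]
    rintro x (rfl | rfl | rfl) <;> linarith
  obtain ⟨u, hu0, hu⟩ := Matrix.exists_mulVec_eq_smul_of_mem_spectrum
    (show θ0 ∈ spectrum ℝ M by simp [hspec])
  have hβ := adjMatrix_mulVec_abs hle hu
  set β : V → ℝ := |u| with hβdef
  have hpos : ∀ x, 0 < β x := fun x =>
    abs_pos.2 (hconn.ne_zero_of_adjMatrix_mulVec_eq hle hu0 hu x)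
  set N := (M - θ1 • 1) * (M - θ2 • 1) with hN
  have hann : (M - θ0 • 1) * N = 0 := hM.mul_sub_eq_zero_of_spectrum_subset hspec.le
  have hcomm : Commute (M - θ2 • 1) (M - θ1 • 1) := by
    refine Commute.sub_left (Commute.sub_right (Commute.refl _) ?_) (Commute.sub_right ?_ ?_)
    · exact (Commute.one_right _).smul_right _
    · exact (Commute.one_left _).smul_left _
    · exact ((Commute.one_left _).smul_left _).smul_right _
  have hsymm : ∀ x y, N x y = N y x := by
    intro x y
    have : Nᵀ = N := by
      have hMt : Mᵀ = M := transpose_adjMatrix ..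
      rw [hN, Matrix.transpose_mul, Matrix.transpose_sub, Matrix.transpose_sub,
        Matrix.transpose_smul, Matrix.transpose_smul, Matrix.transpose_one, hMt, hcomm.eq]
    rw [← this, Matrix.transpose_apply, this]
  have hcol : ∀ x y z, β x * N z y = N x y * β z := by
    intro x y z
    by_contra hne
    have hw : M *ᵥ (β x • N.col y - N x y • β) = θ0 • (β x • N.col y - N x y • β) := by
      have h1 : M *ᵥ N.col y = θ0 • N.col y := by
        rw [Matrix.sub_mul, sub_eq_zero, Matrix.smul_mul, Matrix.one_mul] at hann
        funext z
        exact congrFun (congrFun hann z) y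
      rw [Matrix.mulVec_sub, Matrix.mulVec_smul, Matrix.mulVec_smul, h1, hβ, smul_sub,
        smul_comm, smul_comm (N x y)]
    refine hconn.ne_zero_of_adjMatrix_mulVec_eq hle (fun h0 => hne ?_) hw x ?_
    · have := congrFun h0 z
      simp at this
      linarith
    · simp [mul_comm]
  obtain ⟨o⟩ := hconn.nonempty
  have hNk : ∀ x y, N x y = N o o / β o ^ 2 * (β x * β y) := by
    intro x y
    have h1 := hcol o y x
    have h2 := hcol o o y
    rw [hsymm y o] at h2
    have := hpos o
    field_simp
    linear_combination β o * h1 + β x * h2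
  set k := N o o / β o ^ 2 with hk
  have hkpos : 0 < k := by
    have h1 : N *ᵥ β = ((θ0 - θ1) * (θ0 - θ2)) • β := by
      have h2 : ∀ t : ℝ, (M - t • 1) *ᵥ β = (θ0 - t) • β := by
        intro t
        rw [Matrix.sub_mulVec, Matrix.smul_mulVec, Matrix.one_mulVec, hβ, sub_smul]
      rw [hN, ← Matrix.mulVec_mulVec, h2, Matrix.mulVec_smul, h2, smul_smul, mul_comm]
    have h3 := congrFun h1 o
    simp only [Matrix.mulVec, dotProduct, hNk, Pi.smul_apply, smul_eq_mul] at h3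
    have h4 : 0 < ((θ0 - θ1) * (θ0 - θ2)) * β o :=
      mul_pos (mul_pos (by linarith) (by linarith)) (hpos o)
    rw [← h3] at h4
    by_contra hk'
    refine absurd h4 (not_lt.2 (Finset.sum_nonpos fun x _ => ?_))
    have := mul_pos (hpos o) (hpos x)
    nlinarith [hpos x, mul_pos this (hpos x)]
  refine ⟨√k • β, fun x => ?_, ?_, ?_⟩
  · have := hpos x
    simp only [Pi.smul_apply, smul_eq_mul]
    positivity
  · rw [Matrix.mulVec_smul, hβ, smul_comm]
  · ext x y
    rw [hNk, Matrix.vecMulVec_apply, Pi.smul_apply, Pi.smul_apply, smul_eq_mul, smul_eq_mul]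
    linear_combination (-(β x * β y)) * Real.mul_self_sqrt hkpos.le

section ThreeEigenvalues

variable {θ1 θ2 : ℝ} {α : V → ℝ}

theorem card_inter_neighborFinset_of_rank_one
    (hN : (Γ.adjMatrix ℝ - θ1 • 1) * (Γ.adjMatrix ℝ - θ2 • 1) = Matrix.vecMulVec α α) (x y : V) :
    ((Γ.neighborFinset x ∩ Γ.neighborFinset y).card : ℝ) =
      (if Γ.Adj x y then θ1 + θ2 else 0) - (if x = y then θ1 * θ2 else 0) + α x * α y := by
  have h := congrFun (congrFun hN x) y
  have hMM : (Γ.adjMatrix ℝ * Γ.adjMatrix ℝ) x y =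
      ((Γ.neighborFinset x ∩ Γ.neighborFinset y).card : ℝ) := by
    rw [adjMatrix_mul_apply]
    simp only [adjMatrix_apply, Finset.sum_boole, adj_comm _ _ y]
    congr 2
    ext w
    simp
  rw [Matrix.vecMulVec_apply, sub_mul, mul_sub, mul_sub, Matrix.mul_smul, Matrix.mul_one,
    Matrix.smul_mul, Matrix.one_mul, Matrix.smul_mul, Matrix.one_mul] at h
  simp only [Matrix.sub_apply, Matrix.smul_apply, hMM, adjMatrix_apply, Matrix.one_apply,
    smul_eq_mul] at h
  rw [← h]
  split_ifs <;> ring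

theorem degree_of_rank_one
    (hN : (Γ.adjMatrix ℝ - θ1 • 1) * (Γ.adjMatrix ℝ - θ2 • 1) = Matrix.vecMulVec α α) (x : V) :
    (Γ.degree x : ℝ) = -θ1 * θ2 + α x ^ 2 := by
  have h := card_inter_neighborFinset_of_rank_one hN x x
  rw [Finset.inter_self, card_neighborFinset_eq_degree, if_neg Γ.irrefl, if_pos rfl] at h
  rw [h]
  ring

theorem neg_sub_le_mul_of_adj
    (hN : (Γ.adjMatrix ℝ - θ1 • 1) * (Γ.adjMatrix ℝ - θ2 • 1) = Matrix.vecMulVec α α) {x y : V}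
    (hxy : Γ.Adj x y) : -θ1 - θ2 ≤ α x * α y := by
  have h := card_inter_neighborFinset_of_rank_one hN x y
  rw [if_pos hxy, if_neg hxy.ne] at h
  have : (0 : ℝ) ≤ ((Γ.neighborFinset x ∩ Γ.neighborFinset y).card : ℝ) := Nat.cast_nonneg _
  linarith

theorem card_inter_neighborFinset_of_not_adj
    (hN : (Γ.adjMatrix ℝ - θ1 • 1) * (Γ.adjMatrix ℝ - θ2 • 1) = Matrix.vecMulVec α α) {x y : V}
    (hne : x ≠ y) (hxy : ¬ Γ.Adj x y) :
    ((Γ.neighborFinset x ∩ Γ.neighborFinset y).card : ℝ) = α x * α y := by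
  have h := card_inter_neighborFinset_of_rank_one hN x y
  rw [if_neg hxy, if_neg hne] at h
  linarith

theorem mul_le_of_not_adj
    (hN : (Γ.adjMatrix ℝ - θ1 • 1) * (Γ.adjMatrix ℝ - θ2 • 1) = Matrix.vecMulVec α α) {x y : V}
    (hne : x ≠ y) (hxy : ¬ Γ.Adj x y) : α x * α y ≤ -θ1 * θ2 + α x ^ 2 := by
  rw [← card_inter_neighborFinset_of_not_adj hN hne hxy, ← degree_of_rank_one hN,
    ← card_neighborFinset_eq_degree]
  exact_mod_cast Finset.card_le_card Finset.inter_subset_left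

theorem sum_sq_of_rank_one {θ0 : ℝ} [Nonempty V] (hpos : ∀ x, 0 < α x)
    (hα : Γ.adjMatrix ℝ *ᵥ α = θ0 • α)
    (hN : (Γ.adjMatrix ℝ - θ1 • 1) * (Γ.adjMatrix ℝ - θ2 • 1) = Matrix.vecMulVec α α) :
    ∑ x, α x ^ 2 = (θ0 - θ1) * (θ0 - θ2) := by
  have h : ∀ t : ℝ, (Γ.adjMatrix ℝ - t • 1) *ᵥ α = (θ0 - t) • α := by
    intro t
    rw [Matrix.sub_mulVec, Matrix.smul_mulVec, Matrix.one_mulVec, hα, sub_smul]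
  have h1 := congrArg (· *ᵥ α) hN
  simp only [← Matrix.mulVec_mulVec, h, Matrix.mulVec_smul, smul_smul] at h1
  obtain ⟨o⟩ := ‹Nonempty V›
  have h2 := congrFun h1 o
  simp only [Pi.smul_apply, smul_eq_mul, Matrix.mulVec, dotProduct, Matrix.vecMulVec_apply,
    mul_assoc, ← Finset.mul_sum] at h2
  rw [mul_comm (α o)] at h2
  apply mul_right_cancel₀ (hpos o).ne'
  simp only [pow_two]
  linear_combination -h2

/-- In a cone, the entries of `α` outside of the apex are roots of one quadratic polynomial. -/
theorem quadratic_of_cone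
    (hN : (Γ.adjMatrix ℝ - θ1 • 1) * (Γ.adjMatrix ℝ - θ2 • 1) = Matrix.vecMulVec α α) {v x : V}
    (hv : ∀ y, y ≠ v → Γ.Adj v y) (hx : x ≠ v) :
    α x ^ 2 = α v * α x + θ1 * θ2 + θ1 + θ2 + 1 := by
  have h := card_inter_neighborFinset_of_rank_one hN v x
  rw [if_pos (hv x hx), if_neg hx.symm] at h
  have h1 : Γ.neighborFinset v ∩ Γ.neighborFinset x = (Γ.neighborFinset x).erase v := by
    ext w
    simp only [Finset.mem_inter, mem_neighborFinset, Finset.mem_erase]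
    exact and_congr_left fun _ => ⟨fun hw => hw.ne', hv w⟩
  have h2 : v ∈ Γ.neighborFinset x := by simpa using (hv x hx).symm
  have h3 := Finset.card_erase_add_one h2
  rw [← h1, card_neighborFinset_eq_degree] at h3
  have h4 := degree_of_rank_one hN x
  rw [← h3] at h4
  push_cast at h4
  linarith

theorem quadratic_equation_of_cone {θ0 : ℝ} (hpos : ∀ x, 0 < α x)
    (hα : Γ.adjMatrix ℝ *ᵥ α = θ0 • α)
    (hN : (Γ.adjMatrix ℝ - θ1 • 1) * (Γ.adjMatrix ℝ - θ2 • 1) = Matrix.vecMulVec α α) {v : V}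
    (hv : ∀ y, y ≠ v → Γ.Adj v y) :
    θ0 ^ 2 - (α v ^ 2 + θ1 + θ2) * θ0
      + (α v ^ 2 - θ1 * θ2) * (-θ1 * θ2 - θ1 - θ2 - 2) = 0 := by
  have : Nonempty V := ⟨v⟩
  have hnv : Γ.neighborFinset v = Finset.univ.erase v := by
    ext w
    simp only [mem_neighborFinset, Finset.mem_erase, Finset.mem_univ, and_true]
    exact ⟨fun hw => hw.ne', hv w⟩
  have h1 := congrFun hα v
  rw [adjMatrix_mulVec_apply, hnv, Pi.smul_apply, smul_eq_mul] at h1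
  have h2 := sum_sq_of_rank_one hpos hα hN
  have h3 : ∑ x ∈ Finset.univ.erase v, α x ^ 2 =
      α v * (∑ x ∈ Finset.univ.erase v, α x)
        + (Γ.degree v : ℝ) * (θ1 * θ2 + θ1 + θ2 + 1) := by
    rw [← card_neighborFinset_eq_degree, hnv, Finset.mul_sum, ← nsmul_eq_mul, ← Finset.sum_const,
      ← Finset.sum_add_distrib]
    refine Finset.sum_congr rfl fun x hx => ?_
    rw [quadratic_of_cone hN hv (Finset.ne_of_mem_erase hx)]
    ring
  rw [← Finset.add_sum_erase _ _ (Finset.mem_univ v), h3, h1, degree_of_rank_one hN] at h2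
  linear_combination -h2

end ThreeEigenvalues

/-- The degrees other than that of the apex take two different values in a cone with three
distinct degrees. -/
theorem exists_degree_lt_of_card_image_degree_eq_three
    (hval : ((Finset.univ : Finset V).image (fun v => Γ.degree v)).card = 3) (v : V) :
    ∃ x y, x ≠ v ∧ y ≠ v ∧ Γ.degree y < Γ.degree x := by
  by_contra! h
  obtain ⟨w, hw⟩ : ∃ w, w ≠ v := by
    by_contra! hw
    have : Finset.univ.image (fun v => Γ.degree v) ⊆ {Γ.degree v} := by
      intro d
      simp only [Finset.mem_image, Finset.mem_univ, true_and, Finset.mem_singleton]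
      rintro ⟨x, rfl⟩
      rw [hw x]
    have := Finset.card_le_card this
    simp only [hval, Finset.card_singleton] at this
    omega
  have : Finset.univ.image (fun v => Γ.degree v) ⊆ {Γ.degree v, Γ.degree w} := by
    intro d
    simp only [Finset.mem_image, Finset.mem_univ, true_and, Finset.mem_singleton,
      Finset.mem_insert]
    rintro ⟨x, rfl⟩
    by_cases hx : x = v
    · exact Or.inl (by rw [hx])
    · exact Or.inr (le_antisymm (h x w hx hw) (h w x hw hx))
  have := (Finset.card_le_card this).trans Finset.card_le_two
  omega

theorem adj_of_degree_eq {v : V} (hv : Γ.degree v = Fintype.card V - 1) {y : V} (hy : y ≠ v) :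
    Γ.Adj v y := by
  have h : Γ.neighborFinset v = Finset.univ.erase v := by
    refine Finset.eq_of_subset_of_card_le (fun w hw => ?_) ?_
    · exact Finset.mem_erase.2 ⟨((mem_neighborFinset ..).1 hw).ne', Finset.mem_univ _⟩
    · rw [Finset.card_erase_of_mem (Finset.mem_univ v), card_neighborFinset_eq_degree, hv,
        Finset.card_univ]
  rw [← mem_neighborFinset, h]
  exact Finset.mem_erase.2 ⟨hy, Finset.mem_univ _⟩

theorem exists_not_adj_of_degree_lt {y : V} (h : Γ.degree y < Fintype.card V - 1) :
    ∃ z, z ≠ y ∧ ¬ Γ.Adj y z := by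
  by_contra! hz
  have h1 : Γ.neighborFinset y = Finset.univ.erase y := by
    ext w
    simp only [mem_neighborFinset, Finset.mem_erase, Finset.mem_univ, and_true]
    exact ⟨fun hw => hw.ne', hz w⟩
  rw [← card_neighborFinset_eq_degree, h1, Finset.card_erase_of_mem (Finset.mem_univ y),
    Finset.card_univ] at h
  exact h.false

section Cone

variable {θ1 θ2 : ℝ} {α : V → ℝ} {v x y z : V}

theorem one_le_of_cone (hpos : ∀ x, 0 < α x)
    (hN : (Γ.adjMatrix ℝ - θ1 • 1) * (Γ.adjMatrix ℝ - θ2 • 1) = Matrix.vecMulVec α α)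
    (hsum : α x + α y = α v) (hzy : z ≠ y) (hyz : ¬ Γ.Adj y z) (hz : α z = α x ∨ α z = α y) :
    1 ≤ α y := by
  have key : ∃ k : ℤ, (k : ℝ) = α y ^ 2 := by
    have h := card_inter_neighborFinset_of_not_adj hN hzy.symm hyz
    set m := (Γ.neighborFinset y ∩ Γ.neighborFinset z).card
    rcases hz with hz | hz <;> rw [hz] at h
    · refine ⟨(Γ.degree v : ℤ) - Γ.degree x - 2 * m, ?_⟩
      push_cast
      rw [h, degree_of_rank_one hN, degree_of_rank_one hN, ← hsum]
      ring
    · exact ⟨m, by push_cast; rw [h]; ring⟩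
  obtain ⟨k, hk⟩ := key
  have h0 : (0 : ℝ) < k := hk ▸ pow_pos (hpos y) 2
  have h1 : (1 : ℝ) ≤ k := by exact_mod_cast Int.cast_pos.1 h0
  rw [hk] at h1
  exact (one_le_sq_iff₀ (hpos y).le).1 h1

theorem le_sq_of_cone
    (hN : (Γ.adjMatrix ℝ - θ1 • 1) * (Γ.adjMatrix ℝ - θ2 • 1) = Matrix.vecMulVec α α)
    (hv : ∀ y, y ≠ v → Γ.Adj v y) (hlt : α y < α x)
    (hprod : α x * α y = -θ1 * θ2 + (-θ1 - θ2 - 1)) (hzy : z ≠ y) (hyz : ¬ Γ.Adj y z)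
    (htwo : ∀ w, w ≠ v → α w = α x ∨ α w = α y) :
    -θ1 - θ2 - 1 ≤ α y ^ 2 := by
  by_contra! hlt'
  have htype : ∀ u w, α u = α y → w ≠ u → ¬ Γ.Adj u w → w ≠ v → α w = α y := by
    intro u w hu hwu huw hwv
    refine (htwo w hwv).resolve_left fun hw => ?_
    have := mul_le_of_not_adj hN hwu.symm huw
    rw [hu, hw] at this
    linarith
  have hindep : ∀ u w, α u = α y → α w = α y → ¬ Γ.Adj u w := by
    intro u w hu hw huw
    have := neg_sub_le_mul_of_adj hN huw
    rw [hu, hw] at this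
    linarith
  have hyv : y ≠ v := fun h => hyz (h ▸ hv z (h ▸ hzy))
  have hzv : z ≠ v := fun h => hyz (h ▸ (hv y hyv).symm)
  have hz := htype y z rfl hzy hyz hzv
  have hsub : Γ.neighborFinset y ⊆ Γ.neighborFinset z := by
    intro w hw
    rw [mem_neighborFinset] at hw ⊢
    by_cases hwv : w = v
    · exact hwv ▸ (hv z hzv).symm
    by_contra hzw
    exact hindep y w rfl (htype z w hz (fun h => hyz (h ▸ hw)) hzw hwv) hw
  have h1 := card_inter_neighborFinset_of_not_adj hN hzy.symm hyz
  rw [Finset.inter_eq_left.2 hsub, card_neighborFinset_eq_degree, degree_of_rank_one hN, hz] at h1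
  have hadj : Γ.Adj y x := by
    by_contra hyx
    by_cases hxv : x = v
    · exact hyx (hxv ▸ (hv y hyv).symm)
    · have := htype y x rfl (fun h => hlt.ne' (h ▸ rfl)) hyx hxv
      exact hlt.ne' this
  have := neg_sub_le_mul_of_adj hN hadj
  nlinarith

end Cone

end SimpleGraph

end

/-- Technical bounds for a cone with exactly three distinct eigenvalues
θ0 > θ1 > θ2 and exactly three distinct vertex degrees. -/
theorem cone_with_three_valencies_bounds
    {V : Type} [Fintype V] [DecidableEq V] (Γ : SimpleGraph V) [DecidableRel Γ.Adj]
    (θ0 θ1 θ2 : ℝ)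
    (hconn : Γ.Connected)
    (h01 : θ0 > θ1) (h12 : θ1 > θ2)
    (hspec : spectrum ℝ (Γ.adjMatrix ℝ) = {θ0, θ1, θ2})
    (hcone : ∃ v : V, Γ.degree v = Fintype.card V - 1)
    (hval : ((Finset.univ : Finset V).image (fun v => Γ.degree v)).card = 3) :
    let n : ℝ := (Fintype.card V : ℝ)
    let A : ℝ := -θ1 * θ2
    let B : ℝ := -θ1 - θ2 - 1
    (5 * A + 4 * B + 1 < n ∧ n ≤ (A + B + 1) ^ 2 + A + 1) ∧
    (B > 0 → n ≤ (A + B) ^ 2 / B + 3 * (A + B) + 1) ∧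
    (θ0 ^ 2 - (n - 2 - A - B) * θ0 - (n - 1) * (1 - A - B) = 0) ∧
    (n ≥ 3 * (A + B) + Real.sqrt (8 * (A + B) * (A + B - 1))) := by
  intro n A B
  obtain ⟨α, hpos, hα, hN⟩ := hconn.exists_pos_eigenvector_of_three_eigenvalues h01 h12 hspec
  obtain ⟨v, hdv⟩ := hcone
  have hv : ∀ y, y ≠ v → Γ.Adj v y := fun y => SimpleGraph.adj_of_degree_eq hdv
  obtain ⟨x, y, hxv, hyv, hdeg⟩ :=
    SimpleGraph.exists_degree_lt_of_card_image_degree_eq_three hval v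
  have hlt : α y < α x := by
    have h : (Γ.degree y : ℝ) < Γ.degree x := by exact_mod_cast hdeg
    rw [SimpleGraph.degree_of_rank_one hN, SimpleGraph.degree_of_rank_one hN,
      add_lt_add_iff_left] at h
    exact lt_of_pow_lt_pow_left₀ 2 (hpos x).le h
  have hy := SimpleGraph.quadratic_of_cone hN hv hyv
  have hx := SimpleGraph.quadratic_of_cone hN hv hxv
  have hsum : α x + α y = α v := by
    apply mul_left_cancel₀ (sub_ne_zero.2 hlt.ne')
    linear_combination hx - hy
  have hprod : α x * α y = A + B := by
    simp only [A, B]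
    linear_combination α x * hsum - hx
  have htwo : ∀ w, w ≠ v → α w = α x ∨ α w = α y := by
    intro w hw
    have h := SimpleGraph.quadratic_of_cone hN hv hw
    have : (α w - α x) * (α w - α y) = 0 := by
      linear_combination h - hx - (α w - α x) * hsum
    simpa [sub_eq_zero] using this
  obtain ⟨z, hzy, hyz⟩ := SimpleGraph.exists_not_adj_of_degree_lt
    (hdeg.trans_le (Nat.le_sub_one_of_lt (Γ.degree_lt_card_verts x)))
  have hzv : z ≠ v := fun h => hyz (h ▸ (hv y hyv).symm)
  have hz := htwo z hzv
  have hn : n = α v ^ 2 + A + 1 := by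
    have hcard : Γ.degree v + 1 = Fintype.card V := by
      have := Fintype.card_pos_iff.2 hconn.nonempty
      omega
    simp only [n, A]
    rw [← hcard]
    push_cast
    rw [SimpleGraph.degree_of_rank_one hN]
    ring
  have hA : 0 ≤ A := by
    have h := SimpleGraph.mul_le_of_not_adj hN hzy.symm hyz
    have hle : α y ≤ α z := by
      rcases hz with h | h <;> rw [h]
      exact hlt.le
    simp only [A]
    nlinarith [hpos y]
  have hB : B ≤ α y ^ 2 := SimpleGraph.le_sq_of_cone hN hv hlt hprod hzy hyz htwo
  have hone : 1 ≤ α y := SimpleGraph.one_le_of_cone hpos hN hsum hzy hyz hz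
  have hc : θ0 ^ 2 - (n - 2 - A - B) * θ0 - (n - 1) * (1 - A - B) = 0 := by
    have h := SimpleGraph.quadratic_equation_of_cone hpos hα hN hv
    rw [hn]
    simp only [A, B]
    linear_combination h
  have hn' : n = α x ^ 2 + α y ^ 2 + 2 * (A + B) + A + 1 := by
    rw [hn, ← hsum, ← hprod]
    ring
  have hlow : 5 * A + 4 * B + 1 < n := by
    nlinarith [sq_pos_of_pos (sub_pos.2 hlt)]
  have hC : 0 < A + B := hprod ▸ mul_pos (hpos x) (hpos y)
  refine ⟨⟨hlow, ?_⟩, fun hBpos => ?_, hc, ?_⟩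
  · have h : α v ≤ A + B + 1 := by
      rw [← hprod, ← hsum]
      nlinarith [mul_nonneg (sub_nonneg.2 hone) (sub_nonneg.2 (hone.trans hlt.le))]
    rw [hn]
    gcongr
    exact (hpos v).le
  · have hB' : B ≤ α x ^ 2 := hB.trans (pow_le_pow_left₀ (hpos y).le hlt.le 2)
    have h : α x ^ 2 + α y ^ 2 - B ≤ (A + B) ^ 2 / B := by
      rw [le_div_iff₀ hBpos, ← hprod]
      nlinarith [mul_nonneg (sub_nonneg.2 hB) (sub_nonneg.2 hB')]
    linarith
  · have h : Real.sqrt (8 * (A + B) * (A + B - 1)) ≤ n - 3 * (A + B) := by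
      rw [Real.sqrt_le_iff]
      refine ⟨by linarith, ?_⟩
      nlinarith [sq_nonneg (2 * θ0 - (n - 2 - A - B))]
    linarith
end

section
/- Let Γ be a connected nonregular finite simple graph whose adjacency matrix has exactly three distinct eigenvalues s > 1 > −t, and let x and y be adjacent vertices of Γ. Let C₃ be the set of vertices z ∉ {x,y} that are adjacent to neither x nor y. Then the subgraph of Γ induced on C₃ has maximum degree at most one. -/
open Matrix in
/-- The quadratic form of a real symmetric matrix, expanded in an orthonormal eigenbasis. -/
theorem Matrix.IsHermitian.dotProduct_mulVec_eq_sum_eigenvalues {n : Type*} [Fintype n]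
    [DecidableEq n] {A : Matrix n n ℝ} (hA : A.IsHermitian) (c : ℝ) (v : n → ℝ) :
    v ⬝ᵥ A *ᵥ v - c * (v ⬝ᵥ v) =
      ∑ i, (hA.eigenvalues i - c) * ((hA.eigenvectorBasis i : n → ℝ) ⬝ᵥ v) ^ 2 := by
  have parseval (w : n → ℝ) : v ⬝ᵥ w =
      ∑ i, ((hA.eigenvectorBasis i : n → ℝ) ⬝ᵥ v) * ((hA.eigenvectorBasis i : n → ℝ) ⬝ᵥ w) := by
    have h := hA.eigenvectorBasis.sum_inner_mul_inner (WithLp.toLp 2 v) (WithLp.toLp 2 w)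
    simp only [EuclideanSpace.inner_eq_star_dotProduct, star_trivial] at h
    rw [dotProduct_comm, ← h]
    refine Finset.sum_congr rfl fun i _ => ?_
    rw [dotProduct_comm w]
  have hT : Aᵀ = A := by simpa [IsHermitian, conjTranspose_eq_transpose_of_trivial] using hA
  rw [parseval (A *ᵥ v), parseval v, Finset.mul_sum, ← Finset.sum_sub_distrib]
  refine Finset.sum_congr rfl fun i _ => ?_
  rw [dotProduct_mulVec, ← mulVec_transpose, hT, hA.mulVec_eigenvectorBasis, smul_dotProduct,
    smul_eq_mul]
  ring

open Matrix in
/-- For a real symmetric matrix whose eigenvalues are at most `s`, a vector whose Rayleigh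
quotient is at least `s` is an eigenvector for `s`. -/
theorem Matrix.IsHermitian.mulVec_eq_smul_of_le_dotProduct {n : Type*} [Fintype n] [DecidableEq n]
    {A : Matrix n n ℝ} (hA : A.IsHermitian) {s : ℝ} (hs : ∀ i, hA.eigenvalues i ≤ s)
    {v : n → ℝ} (hv : s * (v ⬝ᵥ v) ≤ v ⬝ᵥ A *ᵥ v) : A *ᵥ v = s • v := by
  have form_eq (w : n → ℝ) : w ⬝ᵥ (s • (1 : Matrix n n ℝ) - A) *ᵥ w =
      -(w ⬝ᵥ A *ᵥ w - s * (w ⬝ᵥ w)) := by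
    simp [sub_mulVec, smul_mulVec, dotProduct_sub, dotProduct_smul]
  have form_nonpos (w : n → ℝ) : w ⬝ᵥ A *ᵥ w - s * (w ⬝ᵥ w) ≤ 0 := by
    rw [hA.dotProduct_mulVec_eq_sum_eigenvalues]
    exact Finset.sum_nonpos fun i _ =>
      mul_nonpos_of_nonpos_of_nonneg (sub_nonpos.2 (hs i)) (sq_nonneg _)
  have hpsd : (s • (1 : Matrix n n ℝ) - A).PosSemidef := by
    refine PosSemidef.of_dotProduct_mulVec_nonneg ?_ fun w => ?_
    · exact (isHermitian_one.smul (IsSelfAdjoint.all s)).sub hA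
    · rw [star_trivial, form_eq]
      linarith [form_nonpos w]
  have h0 := (hpsd.dotProduct_mulVec_zero_iff v).1 <| by
    rw [star_trivial, form_eq]
    linarith [form_nonpos v]
  rw [sub_mulVec, smul_mulVec, one_mulVec, sub_eq_zero] at h0
  exact h0.symm

namespace SimpleGraph

open Matrix

theorem isHermitian_adjMatrix_real_s10 {V : Type*} {Γ : SimpleGraph V} [DecidableRel Γ.Adj] :
    (Γ.adjMatrix ℝ).IsHermitian := by
  rw [IsHermitian, conjTranspose_eq_transpose_of_trivial, transpose_adjMatrix]

variable {V : Type*} [Fintype V] [DecidableEq V] {Γ : SimpleGraph V} [DecidableRel Γ.Adj]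

theorem adjMatrix_mulVec_abs_s10 {s : ℝ}
    (hs : ∀ i, (isHermitian_adjMatrix_real_s10 (Γ := Γ)).eigenvalues i ≤ s) {v : V → ℝ}
    (hv : Γ.adjMatrix ℝ *ᵥ v = s • v) : Γ.adjMatrix ℝ *ᵥ |v| = s • |v| := by
  refine isHermitian_adjMatrix_real_s10.mulVec_eq_smul_of_le_dotProduct hs ?_
  have habs : |v| ⬝ᵥ |v| = v ⬝ᵥ v := by simp [dotProduct]
  rw [habs, ← smul_eq_mul, ← dotProduct_smul, ← hv]
  simp only [dotProduct, adjMatrix_mulVec_apply, Pi.abs_apply]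
  refine Finset.sum_le_sum fun p _ => (le_abs_self _).trans ?_
  rw [abs_mul]
  exact mul_le_mul_of_nonneg_left (Finset.abs_sum_le_sum_abs _ _) (abs_nonneg _)

/-- In a connected graph, an eigenvector for the largest eigenvalue has no zero entry. -/
theorem Connected.eq_zero_of_adjMatrix_mulVec (hΓ : Γ.Connected) {s : ℝ}
    (hs : ∀ i, (isHermitian_adjMatrix_real_s10 (Γ := Γ)).eigenvalues i ≤ s) {v : V → ℝ}
    (hv : Γ.adjMatrix ℝ *ᵥ v = s • v) {x : V} (hx : v x = 0) : v = 0 := by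
  have step {p q : V} (hpq : Γ.Adj p q) (hp : v p = 0) : v q = 0 := by
    have h := congrFun (adjMatrix_mulVec_abs_s10 hs hv) p
    simp only [adjMatrix_mulVec_apply, Pi.smul_apply, Pi.abs_apply, hp, abs_zero, smul_zero] at h
    rw [Finset.sum_eq_zero_iff_of_nonneg fun _ _ => abs_nonneg _] at h
    exact abs_eq_zero.1 (h q ((Γ.mem_neighborFinset p q).2 hpq))
  funext q
  obtain ⟨W⟩ := hΓ.preconnected x q
  induction W with
  | nil => exact hx
  | cons hadj _ ih => exact ih (step hadj hx)

/-- If every eigenvalue of a connected graph other than the largest one is at most `c`, then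
there is a positive vector on whose orthogonal complement the adjacency form is at most `c`. -/
theorem Connected.exists_pos_forall_dotProduct_mulVec_le (hΓ : Γ.Connected) {s c : ℝ} (hcs : c ≤ s)
    (hs : s ∈ spectrum ℝ (Γ.adjMatrix ℝ))
    (hspec : ∀ μ ∈ spectrum ℝ (Γ.adjMatrix ℝ), μ = s ∨ μ ≤ c) :
    ∃ α : V → ℝ, (∀ p, 0 < α p) ∧
      ∀ v : V → ℝ, α ⬝ᵥ v = 0 → v ⬝ᵥ Γ.adjMatrix ℝ *ᵥ v ≤ c * (v ⬝ᵥ v) := by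
  have hA := isHermitian_adjMatrix_real_s10 (Γ := Γ)
  have hval (i : V) : hA.eigenvalues i = s ∨ hA.eigenvalues i ≤ c :=
    hspec _ (hA.eigenvalues_mem_spectrum_real i)
  have hle (i : V) : hA.eigenvalues i ≤ s := (hval i).elim le_of_eq hcs.trans'
  obtain ⟨j, hj⟩ := hA.spectrum_real_eq_range_eigenvalues ▸ hs
  have hvec := hA.mulVec_eigenvectorBasis j
  rw [hj] at hvec
  set e : V → ℝ := (hA.eigenvectorBasis j : V → ℝ)
  have hne (p : V) : e p ≠ 0 := fun hp => by
    have h0 := hΓ.eq_zero_of_adjMatrix_mulVec hle hvec hp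
    refine hA.eigenvectorBasis.orthonormal.ne_zero j ?_
    ext q
    exact congrFun h0 q
  have habs := adjMatrix_mulVec_abs_s10 hle hvec
  refine ⟨|e|, fun p => abs_pos.2 (hne p), fun v hv => ?_⟩
  rw [← sub_nonpos, hA.dotProduct_mulVec_eq_sum_eigenvalues]
  refine Finset.sum_nonpos fun i _ => ?_
  rcases hval i with hi | hi
  · have hvi := hA.mulVec_eigenvectorBasis i
    rw [hi] at hvi
    set f : V → ℝ := (hA.eigenvectorBasis i : V → ℝ)
    have hpos : |e| j ≠ 0 := (abs_pos.2 (hne j)).ne'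
    have hker : f - (f j / |e| j) • |e| = 0 := by
      refine hΓ.eq_zero_of_adjMatrix_mulVec hle (x := j) ?_ ?_
      · rw [mulVec_sub, mulVec_smul, hvi, habs, smul_sub, smul_comm]
      · rw [Pi.sub_apply, Pi.smul_apply, smul_eq_mul, div_mul_cancel₀ _ hpos, sub_self]
    rw [sub_eq_zero.1 hker, smul_dotProduct, hv]
    simp
  · exact mul_nonpos_of_nonpos_of_nonneg (sub_nonpos.2 hi) (sq_nonneg _)

/-- If the adjacency form is at most `1` on the orthogonal complement of a positive vector, then
the vertices nonadjacent to both ends of an edge induce a graph of maximum degree at most one. -/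
theorem eq_of_adj_of_adj_of_forall_dotProduct_mulVec_le {α : V → ℝ} (hα : ∀ p, 0 < α p)
    (hform : ∀ v : V → ℝ, α ⬝ᵥ v = 0 → v ⬝ᵥ Γ.adjMatrix ℝ *ᵥ v ≤ 1 * (v ⬝ᵥ v))
    {x y z w u : V} (hxy : Γ.Adj x y)
    (hz : z ≠ x ∧ z ≠ y ∧ ¬ Γ.Adj z x ∧ ¬ Γ.Adj z y)
    (hw : w ≠ x ∧ w ≠ y ∧ ¬ Γ.Adj w x ∧ ¬ Γ.Adj w y)
    (hu : u ≠ x ∧ u ≠ y ∧ ¬ Γ.Adj u x ∧ ¬ Γ.Adj u y)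
    (hzw : Γ.Adj z w) (hzu : Γ.Adj z u) : w = u := by
  by_contra hwu
  obtain ⟨hzx, hzy, hzx', hzy'⟩ := hz
  obtain ⟨hwx, hwy, hwx', hwy'⟩ := hw
  obtain ⟨hux, huy, hux', huy'⟩ := hu
  set a : ℝ := α z + α w + α u
  set b : ℝ := α x + α y
  have hb : 0 < b := add_pos (hα x) (hα y)
  have h := hform (a • (Pi.single x 1 + Pi.single y 1)
      - b • (Pi.single z 1 + Pi.single w 1 + Pi.single u 1)) (by
    simp only [dotProduct_sub, dotProduct_add, dotProduct_smul, dotProduct_single,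
      smul_eq_mul, a, b]
    ring)
  have hwz := hzw.symm
  have huz := hzu.symm
  have hyx := hxy.symm
  have e1 := Γ.adj_comm x z
  have e2 := Γ.adj_comm y z
  have e3 := Γ.adj_comm x w
  have e4 := Γ.adj_comm y w
  have e5 := Γ.adj_comm x u
  have e6 := Γ.adj_comm y u
  have e7 := Γ.adj_comm u w
  simp only [mulVec_sub, mulVec_add, mulVec_smul, dotProduct_sub, sub_dotProduct, add_dotProduct,
    smul_dotProduct, dotProduct_add, dotProduct_smul, mulVec_single_one, single_one_dotProduct,
    Pi.single_apply, adjMatrix_apply, col_apply, smul_eq_mul, e1, e2, e3, e4,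
    e5, e6, e7] at h
  simp [*, hxy.ne, hxy.ne', hzw.ne, hzw.ne', hzu.ne, hzu.ne', Ne.symm hwu, Ne.symm hwx, Ne.symm hwy,
    Ne.symm hux, Ne.symm huy, Ne.symm hzx, Ne.symm hzy] at h
  split_ifs at h <;> nlinarith

end SimpleGraph

/-- For a graph in H(s,t) and adjacent vertices x ~ y, the subgraph induced on the set
C₃ of vertices outside {x,y} adjacent to neither x nor y has maximum degree at most 1. -/
theorem H_st_nonneighbours_induce_max_degree_one
    {V : Type} [Fintype V] [DecidableEq V] (Γ : SimpleGraph V) [DecidableRel Γ.Adj]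
    (s t : ℝ)
    (hconn : Γ.Connected)
    (hnonreg : ¬ ∃ k, Γ.IsRegularOfDegree k)
    (hs : 1 < s) (ht : -t < 1)
    (hspec : spectrum ℝ (Γ.adjMatrix ℝ) = {s, 1, -t})
    (x y : V) (hxy : Γ.Adj x y) :
    let C₃ : Set V := {z | z ≠ x ∧ z ≠ y ∧ ¬ Γ.Adj z x ∧ ¬ Γ.Adj z y}
    ∀ z ∈ C₃, ∀ w ∈ C₃, ∀ u ∈ C₃, Γ.Adj z w → Γ.Adj z u → w = u := by
  intro C₃ z hz w hw u hu hzw hzu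
  obtain ⟨α, hα, hform⟩ := hconn.exists_pos_forall_dotProduct_mulVec_le (s := s) (c := 1) hs.le
    (by simp [hspec]) (by
      rw [hspec]
      rintro μ (rfl | rfl | rfl)
      exacts [.inl rfl, .inr le_rfl, .inr ht.le])
  exact SimpleGraph.eq_of_adj_of_adj_of_forall_dotProduct_mulVec_le hα hform hxy hz hw hu hzw hzu
end
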